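/- For all integers n and k with 2 ≤ k ≤ (1/648)·log log n, there exists a graph G on n vertices such that: (i) G has average degree at least k and maximum degree at most 6k; (ii) G has girth at least log n/(6k)²; and (iii) every subgraph H of G on t vertices with t ≥ log n/(6k)² satisfies sepV(H) ≤ sep(H) ≤ (t/log t)·(log log t)². -/

import Mathlib

open SimpleGraph

/-- The set of edges of `G` with exactly one endpoint in `A` (the edge boundary of `A`). -/
noncomputable def cutEdges {V : Type*} (G : SimpleGraph V) (A : Set V) : Set (Sym2 V) :=
  {e | e ∈ G.edgeSet ∧ ∃ u ∈ A, ∃ v ∈ Aᶜ, e = s(u, v)}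

/-- `sep G`: minimum size of an edge separator of `G`, i.e. the minimum number of crossing
edges over all partitions `V = A ⊔ Aᶜ` with `|A| ≤ 2|V|/3` and `|Aᶜ| ≤ 2|V|/3`. -/
noncomputable def sep {V : Type*} (G : SimpleGraph V) : ℕ :=
  sInf { m : ℕ | ∃ A : Set V, 3 * A.ncard ≤ 2 * Nat.card V ∧
      3 * Aᶜ.ncard ≤ 2 * Nat.card V ∧ m = (cutEdges G A).ncard }

/-- `sepV G`: minimum size of a vertex separator of `G`, i.e. the minimum size of a set `S`
such that `V ∖ S` can be partitioned into `A`, `B`, each of size at most `2|V|/3`, with no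
edge of `G` between `A` and `B`. -/
noncomputable def sepV {V : Type*} (G : SimpleGraph V) : ℕ :=
  sInf { m : ℕ | ∃ S A B : Set V, S ∪ A ∪ B = Set.univ ∧
      Disjoint S A ∧ Disjoint S B ∧ Disjoint A B ∧
      3 * A.ncard ≤ 2 * Nat.card V ∧ 3 * B.ncard ≤ 2 * Nat.card V ∧
      (∀ a ∈ A, ∀ b ∈ B, ¬ G.Adj a b) ∧ m = S.ncard }

/-- A graph in which every vertex subset of more than two thirds of the vertices has a cut of
sparsity at most `a` has a balanced cut with at most `a` times the number of vertices edges. -/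
theorem exists_balanced_cut_of_sparse_cuts {β : Type*} [Fintype β] [DecidableEq β]
    (K : SimpleGraph β) [DecidableRel K.Adj] (a : ℝ) (ha : 0 ≤ a)
    (h : ∀ W : Finset β, 2 * Fintype.card β < 3 * W.card → ∃ B ⊆ W, B.Nonempty ∧
      2 * B.card ≤ W.card ∧ ((K.interedges (W \ B) B).card : ℝ) ≤ a * B.card) :
    ∃ A : Finset β, 3 * A.card ≤ 2 * Fintype.card β ∧ 3 * Aᶜ.card ≤ 2 * Fintype.card β ∧
      ((K.interedges A Aᶜ).card : ℝ) ≤ a * Fintype.card β := by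
  let S : Finset (Finset β) := Finset.univ.filter fun W =>
    Fintype.card β ≤ 3 * W.card ∧ ((K.interedges W Wᶜ).card : ℝ) ≤ a * Wᶜ.card
  have hS : S.Nonempty := ⟨Finset.univ, by
    simp only [S, Finset.mem_filter, Finset.mem_univ, true_and, Finset.compl_univ]
    exact ⟨by rw [Finset.card_univ]; omega, by simp [SimpleGraph.interedges, Rel.interedges]⟩⟩
  obtain ⟨W, hWS, hmin⟩ := S.exists_min_image Finset.card hS
  obtain ⟨hW1, hW2⟩ := (Finset.mem_filter.mp hWS).2
  have hWc := Finset.card_add_card_compl W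
  refine ⟨W, ?_, by omega, hW2.trans ?_⟩
  · by_contra! hlt
    obtain ⟨B, hBW, hBne, hB2, hcut⟩ := h W hlt
    have hBpos := hBne.card_pos
    have hcard := Finset.card_sdiff_add_card_eq_card hBW
    have hcc := Finset.card_add_card_compl (W \ B)
    have hcompl : (W \ B)ᶜ = Wᶜ ∪ B := by
      ext x; simp only [Finset.mem_compl, Finset.mem_sdiff, Finset.mem_union]; tauto
    have hmem : W \ B ∈ S := by
      refine Finset.mem_filter.mpr ⟨Finset.mem_univ _, by omega, ?_⟩
      have h1 : (K.interedges (W \ B) (W \ B)ᶜ).card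
          ≤ (K.interedges W Wᶜ).card + (K.interedges (W \ B) B).card := by
        refine (Finset.card_le_card ?_).trans (Finset.card_union_le _ _)
        intro e he
        rw [hcompl] at he
        simp only [SimpleGraph.mem_interedges_iff, Finset.mem_union, Finset.mem_sdiff,
          Finset.mem_compl] at he ⊢
        tauto
      have h2 : (W \ B)ᶜ.card = Wᶜ.card + B.card := by omega
      rw [h2]
      push_cast
      have h3 : ((K.interedges (W \ B) (W \ B)ᶜ).card : ℝ)
          ≤ (K.interedges W Wᶜ).card + (K.interedges (W \ B) B).card := by exact_mod_cast h1
      linarith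
    have := hmin _ hmem
    omega
  · gcongr
    exact Finset.card_le_univ _

/-- Transfer of a cut from an induced subgraph to the ambient graph. -/
theorem exists_cut_of_comap_cut {β : Type*} [Fintype β] [DecidableEq β]
    (K : SimpleGraph β) [DecidableRel K.Adj] (a : ℝ) (W : Finset β)
    (h : ∃ B : Finset W, B.Nonempty ∧ 2 * B.card ≤ W.card ∧
      (((K.comap ((↑) : W → β)).interedges B Bᶜ).card : ℝ) ≤ a * B.card) :
    ∃ B ⊆ W, B.Nonempty ∧
      2 * B.card ≤ W.card ∧ ((K.interedges (W \ B) B).card : ℝ) ≤ a * B.card := by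
  obtain ⟨B, hne, h2, hcut⟩ := h
  refine ⟨B.map (Function.Embedding.subtype _), ?_, by simpa using hne, by simpa using h2, ?_⟩
  · intro x hx
    obtain ⟨y, -, rfl⟩ := Finset.mem_map.mp hx
    exact y.2
  · rw [Finset.card_map]
    refine le_trans ?_ hcut
    rw [Nat.cast_le]
    refine Finset.card_le_card_of_surjOn (fun e => ((e.2 : β), (e.1 : β))) ?_
    rintro ⟨x, y⟩ he
    simp only [Finset.mem_coe, SimpleGraph.mem_interedges_iff, Finset.mem_sdiff,
      Finset.mem_map, Function.Embedding.subtype_apply, Subtype.exists, exists_and_right,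
      exists_eq_right, not_exists] at he
    obtain ⟨⟨hxW, hxB⟩, ⟨hyW, hyB⟩, hadj⟩ := he
    refine ⟨(⟨y, hyW⟩, ⟨x, hxW⟩), ?_, rfl⟩
    simp only [Finset.mem_coe, SimpleGraph.mem_interedges_iff, Finset.mem_compl]
    exact ⟨hyB, hxB hxW, hadj.symm⟩

theorem sepV_le_sep_and_sep_le {β : Type*} [Fintype β] [DecidableEq β]
    (K : SimpleGraph β) [DecidableRel K.Adj] (A : Finset β)
    (h1 : 3 * A.card ≤ 2 * Fintype.card β) (h2 : 3 * Aᶜ.card ≤ 2 * Fintype.card β) :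
    sepV K ≤ sep K ∧ sep K ≤ (K.interedges A Aᶜ).card := by
  have hmem : (cutEdges K (A : Set β)).ncard ∈ { m : ℕ | ∃ A : Set β,
      3 * A.ncard ≤ 2 * Nat.card β ∧ 3 * Aᶜ.ncard ≤ 2 * Nat.card β ∧
        m = (cutEdges K A).ncard } := by
    refine ⟨A, ?_, ?_, rfl⟩
    · simpa using h1
    · rw [← Finset.coe_compl, Set.ncard_coe_finset]
      simpa using h2
  constructor
  · obtain ⟨C, hC1, hC2, hC⟩ := Nat.sInf_mem ⟨_, hmem⟩
    change sep K = _ at hC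
    rw [hC]
    have hf : ∀ e : Sym2 β, ∃ u, e ∈ cutEdges K C → u ∈ C ∧ ∃ v ∈ Cᶜ, e = s(u, v) := by
      intro e
      by_cases he : e ∈ cutEdges K C
      · obtain ⟨-, u, hu, v, hv, rfl⟩ := he
        exact ⟨u, fun _ => ⟨hu, v, hv, rfl⟩⟩
      · exact ⟨e.out.1, fun h => absurd h he⟩
    choose f hf using hf
    refine le_trans (Nat.sInf_le (m := (f '' cutEdges K C).ncard) ?_) (Set.ncard_image_le)
    have hsub : f '' cutEdges K C ⊆ C := by
      rintro _ ⟨e, he, rfl⟩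
      exact (hf e he).1
    refine ⟨f '' cutEdges K C, C \ (f '' cutEdges K C), Cᶜ, ?_, ?_, ?_, ?_, ?_, hC2, ?_, rfl⟩
    · rw [Set.union_sdiff_cancel hsub, Set.union_compl_self]
    · exact Set.disjoint_sdiff_right
    · exact Set.disjoint_compl_right_iff_subset.mpr hsub
    · exact Set.disjoint_compl_right_iff_subset.mpr Set.sdiff_subset
    · exact le_trans (Nat.mul_le_mul_left 3 (Set.ncard_le_ncard Set.sdiff_subset)) hC1
    · rintro x ⟨hxC, hx⟩ y hy hxy
      refine hx ⟨s(x, y), ⟨hxy, x, hxC, y, hy, rfl⟩, ?_⟩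
      obtain ⟨hu, v, hv, he⟩ := hf s(x, y) ⟨hxy, x, hxC, y, hy, rfl⟩
      rcases Sym2.eq_iff.mp he with ⟨h, -⟩ | ⟨-, h⟩
      · exact h.symm
      · exact absurd (h ▸ hu) hy
  · refine (Nat.sInf_le hmem).trans ?_
    have : cutEdges K (A : Set β) ⊆
        ((K.interedges A Aᶜ).image fun e => s(e.1, e.2) : Finset (Sym2 β)) := by
      rintro _ ⟨he, u, hu, v, hv, rfl⟩
      simp only [Finset.coe_image, Set.mem_image, Finset.mem_coe]
      refine ⟨(u, v), ?_, rfl⟩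
      simpa [SimpleGraph.mem_interedges_iff] using ⟨hu, hv, he⟩
    exact (Set.ncard_le_ncard this (Finset.finite_toSet _)).trans
      ((Set.ncard_coe_finset _).le.trans Finset.card_image_le)

theorem walk_eq_of_length_add_lt_girth {α : Type*} {F : SimpleGraph α} {g : ℕ}
    (hg : ∀ (v : α) (w : F.Walk v v), w.IsCycle → g ≤ w.length) {u v : α}
    {p q : F.Walk u v} (hp : p.IsPath) (hq : q.IsPath) (h : p.length + q.length < g) :
    p = q := by
  classical
  set E : Set (Sym2 α) := {e | e ∈ p.edges ∨ e ∈ q.edges} with hE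
  have hdiag : ∀ e ∈ E, e ∈ (fromEdgeSet E).edgeSet := by
    intro e he
    rw [edgeSet_fromEdgeSet]
    refine ⟨he, ?_⟩
    have : e ∈ F.edgeSet := by
      rcases he with he | he
      · exact p.edges_subset_edgeSet he
      · exact q.edges_subset_edgeSet he
    exact F.not_isDiag_of_mem_edgeSet this
  have hle : fromEdgeSet E ≤ F := by
    intro x y hxy
    rw [fromEdgeSet_adj] at hxy
    rcases hxy.1 with he | he
    · exact p.edges_subset_edgeSet he
    · exact q.edges_subset_edgeSet he
  have hp' : ∀ e ∈ p.edges, e ∈ (fromEdgeSet E).edgeSet := fun e he => hdiag e (Or.inl he)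
  have hq' : ∀ e ∈ q.edges, e ∈ (fromEdgeSet E).edgeSet := fun e he => hdiag e (Or.inr he)
  have hac : (fromEdgeSet E).IsAcyclic := by
    intro x c hc
    have h1 := hg x (c.mapLe hle) (hc.mapLe hle)
    have h2 : c.edges.toFinset ⊆ p.edges.toFinset ∪ q.edges.toFinset := by
      intro e he
      have := c.edges_subset_edgeSet (List.mem_toFinset.mp he)
      rw [edgeSet_fromEdgeSet] at this
      simpa [hE] using this.1
    have h3 := (Finset.card_le_card h2).trans (Finset.card_union_le _ _)
    rw [List.toFinset_card_of_nodup hc.isTrail.edges_nodup] at h3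
    have h4 := List.toFinset_card_le p.edges
    have h5 := List.toFinset_card_le q.edges
    simp only [Walk.length_edges, Walk.length_map, Walk.mapLe] at *
    omega
  have := (hac.subsingleton_path u v).elim ⟨_, hp.transfer hp'⟩ ⟨_, hq.transfer hq'⟩
  have hs := congrArg (fun w : (fromEdgeSet E).Path u v => w.1.support) this
  simp only [Walk.support_transfer] at hs
  exact Walk.ext_support hs

/-- Below half the girth, a vertex has at most one neighbour that is not further from the root. -/
theorem eq_of_adj_of_dist_le {α : Type*} {F : SimpleGraph α} (hF : F.Connected) {g : ℕ}
    (hg : ∀ (v : α) (w : F.Walk v v), w.IsCycle → g ≤ w.length) {v u x y : α}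
    (hx : F.Adj x u) (hy : F.Adj y u) (hxu : F.dist v x ≤ F.dist v u)
    (hyu : F.dist v y ≤ F.dist v u) (h : 2 * F.dist v u + 2 < g) : x = y := by
  classical
  have key : ∀ z, F.Adj z u → F.dist v z ≤ F.dist v u →
      ∃ p : F.Walk v z, p.length = F.dist v z ∧ p.IsPath ∧ u ∉ p.support := by
    intro z hz hzu
    obtain ⟨p, hp, hpl⟩ := hF.exists_path_of_dist v z
    refine ⟨p, hpl, hp, fun hu => ?_⟩
    have h1 := p.length_takeUntil_lt_length hu hz.ne'
    have h2 := dist_le (p.takeUntil u hu)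
    omega
  obtain ⟨p, hpl, hp, hpu⟩ := key x hx hxu
  obtain ⟨q, hql, hq, hqu⟩ := key y hy hyu
  have := walk_eq_of_length_add_lt_girth hg (hp.concat hpu hx) (hq.concat hqu hy) (by
    simp only [Walk.length_concat]; omega)
  exact (Walk.concat_inj this).1

theorem exists_adj_dist_add_one {α : Type*} {F : SimpleGraph α} (hF : F.Connected) {v u : α}
    (h : u ≠ v) : ∃ x, F.Adj x u ∧ F.dist v x + 1 = F.dist v u := by
  obtain ⟨p, hp⟩ := hF.exists_walk_length_eq_dist u v
  cases p with
  | nil => exact absurd rfl h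
  | @cons _ x _ hux p =>
    refine ⟨x, hux.symm, ?_⟩
    rw [Walk.length_cons] at hp
    have h1 := dist_le p
    have h2 := hF.dist_triangle (u := u) (v := x) (w := v)
    rw [dist_eq_one_iff_adj.mpr hux] at h2
    rw [dist_comm (u := v), dist_comm (u := v)]
    omega

theorem exists_empty_cut_of_not_connected {α : Type*} [Fintype α] [DecidableEq α] [Nonempty α]
    {F : SimpleGraph α} [DecidableRel F.Adj] (hF : ¬ F.Connected) :
    ∃ B : Finset α, B.Nonempty ∧ 2 * B.card ≤ Fintype.card α ∧ F.interedges B Bᶜ = ∅ := by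
  classical
  have : ∃ u v, ¬ F.Reachable u v := by
    by_contra! h
    exact hF ⟨h⟩
  obtain ⟨u, v, huv⟩ := this
  set S : Finset α := Finset.univ.filter fun z => F.Reachable u z with hS
  have hu : u ∈ S := by simp [hS]
  have hv : v ∈ Sᶜ := by simpa [hS] using huv
  have hcut : ∀ x ∈ S, ∀ y ∈ Sᶜ, ¬ F.Adj x y := by
    intro x hx y hy hxy
    simp only [hS, Finset.mem_compl, Finset.mem_filter, Finset.mem_univ, true_and] at hx hy
    exact hy (hx.trans hxy.reachable)
  have hc := Finset.card_add_card_compl S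
  by_cases h2 : 2 * S.card ≤ Fintype.card α
  · refine ⟨S, ⟨u, hu⟩, h2, Finset.eq_empty_of_forall_notMem ?_⟩
    rintro ⟨x, y⟩ he
    rw [mem_interedges_iff] at he
    exact hcut x he.1 y he.2.1 he.2.2
  · refine ⟨Sᶜ, ⟨v, hv⟩, by omega, Finset.eq_empty_of_forall_notMem ?_⟩
    rintro ⟨x, y⟩ he
    rw [mem_interedges_iff, compl_compl] at he
    exact hcut y he.2.1 x he.1 he.2.2.symm

/-- A graph of bounded degree with a root, all of whose edges join a vertex to its parent, has
a subset of at most half of the vertices which is large and bounded by at most one edge. -/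
theorem exists_sparse_cut_of_parent {α : Type*} [Fintype α] [DecidableEq α]
    {F : SimpleGraph α} [DecidableRel F.Adj] {Δ : ℕ} (hΔ : ∀ x, F.degree x ≤ Δ) {a : ℝ}
    (ha : 0 < a) (hm : 2 * (Δ : ℝ) < a * (Fintype.card α - 1)) (v : α) (p : α → α) (D : α → ℕ)
    (hpv : p v = v) (hpD : ∀ x, x ≠ v → D (p x) < D x) (hpadj : ∀ x, x ≠ v → F.Adj (p x) x)
    (hadj : ∀ x y, F.Adj x y → (x ≠ v ∧ y = p x) ∨ (y ≠ v ∧ x = p y)) :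
    ∃ B : Finset α, B.Nonempty ∧ 2 * B.card ≤ Fintype.card α ∧
      ((F.interedges B Bᶜ).card : ℝ) ≤ a * B.card := by
  classical
  by_contra! hno
  set desc : α → Finset α := fun x => Finset.univ.filter fun z => ∃ j, p^[j] z = x with hdesc
  have hmem : ∀ x z, z ∈ desc x ↔ ∃ j, p^[j] z = x := by simp [hdesc]
  have hself : ∀ x, x ∈ desc x := fun x => (hmem _ _).mpr ⟨0, rfl⟩
  have hroot : desc v = Finset.univ := by
    refine Finset.eq_univ_of_forall ?_
    have : ∀ n z, D z ≤ n → z ∈ desc v := by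
      intro n
      induction n with
      | zero =>
        intro z hz
        by_cases hzv : z = v
        · exact hzv ▸ hself v
        · have := hpD z hzv
          omega
      | succ n ih =>
        intro z hz
        by_cases hzv : z = v
        · exact hzv ▸ hself v
        · have := hpD z hzv
          obtain ⟨j, hj⟩ := (hmem _ _).mp (ih (p z) (by omega))
          exact (hmem _ _).mpr ⟨j + 1, hj⟩
    exact fun z => this _ z le_rfl
  set S : Finset α := Finset.univ.filter fun x => Fintype.card α < 2 * (desc x).card with hS
  have hcardpos : 0 < Fintype.card α := Fintype.card_pos_iff.mpr ⟨v⟩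
  have hSne : S.Nonempty := ⟨v, by
    simp only [hS, Finset.mem_filter, Finset.mem_univ, true_and, hroot, Finset.card_univ]
    omega⟩
  obtain ⟨x, hxS, hxmax⟩ := S.exists_max_image D hSne
  have hx : Fintype.card α < 2 * (desc x).card := (Finset.mem_filter.mp hxS).2
  set C : Finset α := Finset.univ.filter fun c => c ≠ v ∧ p c = x with hC
  have hCΔ : C.card ≤ Δ := by
    refine (Finset.card_le_card ?_).trans (hΔ x)
    intro c hc
    obtain ⟨hcv, hcx⟩ := (Finset.mem_filter.mp hc).2
    rw [mem_neighborFinset]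
    exact hcx ▸ hpadj c hcv
  have hcover : desc x ⊆ {x} ∪ C.biUnion desc := by
    intro z hz
    obtain ⟨j, hj⟩ := (hmem _ _).mp hz
    induction j with
    | zero => exact Finset.mem_union_left _ (Finset.mem_singleton.mpr hj)
    | succ j ih =>
      rw [Function.iterate_succ_apply'] at hj
      by_cases hcv : p^[j] z = v
      · rw [hcv, hpv] at hj
        exact ih (hcv.trans hj)
      · refine Finset.mem_union_right _ (Finset.mem_biUnion.mpr ⟨p^[j] z, ?_, ?_⟩)
        · exact Finset.mem_filter.mpr ⟨Finset.mem_univ _, hcv, hj⟩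
        · exact (hmem _ _).mpr ⟨j, rfl⟩
  have hcut : ∀ c, F.interedges (desc c) (desc c)ᶜ ⊆ {(c, p c)} := by
    rintro c ⟨y, z⟩ he
    rw [mem_interedges_iff, Finset.mem_compl] at he
    obtain ⟨hy, hz, hyz⟩ := he
    obtain ⟨j, hj⟩ := (hmem _ _).mp hy
    rcases hadj y z hyz with ⟨-, rfl⟩ | ⟨-, rfl⟩
    · cases j with
      | zero => simp_all
      | succ j => exact absurd ((hmem _ _).mpr ⟨j, hj⟩) hz
    · exact absurd ((hmem _ _).mpr ⟨j + 1, hj⟩) hz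
  have hsmall : ∀ c ∈ C, a * (desc c).card ≤ 1 := by
    intro c hc
    obtain ⟨hcv, hcx⟩ := (Finset.mem_filter.mp hc).2
    have h2 : 2 * (desc c).card ≤ Fintype.card α := by
      by_contra! hlt
      have h3 := hxmax c (Finset.mem_filter.mpr ⟨Finset.mem_univ _, hlt⟩)
      have h4 := hpD c hcv
      rw [hcx] at h4
      omega
    have h3 := hno (desc c) ⟨c, hself c⟩ h2
    have h4 : ((F.interedges (desc c) (desc c)ᶜ).card : ℝ) ≤ 1 := by
      exact_mod_cast (Finset.card_le_card (hcut c)).trans (by simp)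
    linarith
  have h1 : (desc x).card ≤ 1 + ∑ c ∈ C, (desc c).card :=
    (Finset.card_le_card hcover).trans ((Finset.card_union_le _ _).trans (by
      gcongr
      · simp
      · exact Finset.card_biUnion_le))
  have h2 : a * ∑ c ∈ C, ((desc c).card : ℝ) ≤ Δ := by
    rw [Finset.mul_sum]
    refine (Finset.sum_le_card_nsmul _ _ 1 hsmall).trans ?_
    simpa using hCΔ
  have h3 : ((desc x).card : ℝ) ≤ 1 + ∑ c ∈ C, ((desc c).card : ℝ) := by exact_mod_cast h1
  have h4 : (Fintype.card α : ℝ) + 1 ≤ 2 * (desc x).card := by exact_mod_cast hx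
  nlinarith

/-- A graph of bounded degree and large girth `g` has cuts of sparsity about `log m / g`, where
`m` is the number of vertices. -/
theorem exists_sparse_cut_of_girth {α : Type*} [Fintype α] [DecidableEq α]
    (F : SimpleGraph α) [DecidableRel F.Adj] {Δ g R : ℕ} (hΔ : ∀ x, F.degree x ≤ Δ)
    (hg : ∀ (v : α) (w : F.Walk v v), w.IsCycle → g ≤ w.length) {a : ℝ}
    (ha : 0 < a) (hm : 2 * (Δ : ℝ) < a * (Fintype.card α - 1))
    (hR : (Fintype.card α : ℝ) < (1 + a) ^ R) (hRg : 4 * R + 2 < g) :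
    ∃ B : Finset α, B.Nonempty ∧ 2 * B.card ≤ Fintype.card α ∧
      ((F.interedges B Bᶜ).card : ℝ) ≤ a * B.card := by
  classical
  have hne : Nonempty α := by
    rw [← Fintype.card_pos_iff]
    by_contra! h0
    have h1 : (Fintype.card α : ℝ) = 0 := by exact_mod_cast Nat.le_zero.mp h0
    rw [h1] at hm
    have : (0 : ℝ) ≤ Δ := Nat.cast_nonneg _
    linarith
  by_cases hF : F.Connected
  swap
  · obtain ⟨B, h1, h2, h3⟩ := exists_empty_cut_of_not_connected hF
    exact ⟨B, h1, h2, by rw [h3]; simp; positivity⟩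
  obtain ⟨v⟩ := hne
  by_contra! hno
  set ball : ℕ → Finset α := fun r => Finset.univ.filter fun z => F.dist v z ≤ r with hball
  have hmem : ∀ r z, z ∈ ball r ↔ F.dist v z ≤ r := by simp [hball]
  have hmono : ∀ r, ball r ⊆ ball (r + 1) := fun r z hz => by
    rw [hmem] at hz ⊢
    omega
  have hbdry : ∀ r, r < 2 * R →
      ((F.interedges (ball r) (ball r)ᶜ).card : ℝ) + (ball r).card ≤ (ball (r + 1)).card := by
    intro r hr
    have h1 : (F.interedges (ball r) (ball r)ᶜ).card ≤ (ball (r + 1) \ ball r).card := by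
      have haux : ∀ e ∈ F.interedges (ball r) (ball r)ᶜ,
          F.Adj e.1 e.2 ∧ F.dist v e.1 ≤ r ∧ F.dist v e.2 = r + 1 := by
        rintro ⟨x, u⟩ he
        rw [mem_interedges_iff, Finset.mem_compl, hmem, hmem] at he
        have h2 := hF.dist_triangle (u := v) (v := x) (w := u)
        rw [dist_eq_one_iff_adj.mpr he.2.2] at h2
        exact ⟨he.2.2, he.1, by dsimp only at *; omega⟩
      refine Finset.card_le_card_of_injOn Prod.snd ?_ ?_
      · intro e he
        obtain ⟨-, -, h3⟩ := haux e he
        simp only [Finset.coe_sdiff, Set.mem_sdiff, Finset.mem_coe, hmem, h3]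
        omega
      · intro e he f hf hef
        obtain ⟨h1, h2, h3⟩ := haux e he
        obtain ⟨k1, k2, k3⟩ := haux f hf
        refine Prod.ext (eq_of_adj_of_dist_le hF hg h1 (hef ▸ k1) (v := v) ?_ ?_ ?_) hef <;> omega
    rw [Finset.card_sdiff_of_subset (hmono r)] at h1
    have h2 := Finset.card_le_card (hmono r)
    exact_mod_cast (by omega : _ + (ball r).card ≤ _)
  have hgrow : ∀ r ≤ 2 * R, 2 * (ball r).card ≤ Fintype.card α →
      (1 + a) ^ r ≤ (ball r).card := by
    intro r
    induction r with
    | zero =>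
      intro _ _
      have : (ball 0).Nonempty := ⟨v, by simp [hmem]⟩
      simpa using this.card_pos
    | succ r ih =>
      intro hr h2
      have h3 := Finset.card_le_card (hmono r)
      have h4 := ih (by omega) (by omega)
      have h5 := hno (ball r) ⟨v, by simp [hmem]⟩ (by omega)
      have h6 := hbdry r (by omega)
      rw [pow_succ]
      nlinarith
  have hhalf : Fintype.card α < 2 * (ball R).card := by
    by_contra! hle
    have h1 := hgrow R (by omega) hle
    have h2 : ((ball R).card : ℝ) ≤ Fintype.card α := by exact_mod_cast Finset.card_le_univ _
    linarith
  have hshrink : ∀ j ≤ R, (1 + a) ^ j * ((ball (R + j))ᶜ.card : ℝ) ≤ Fintype.card α := by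
    intro j
    induction j with
    | zero =>
      intro _
      simp only [pow_zero, one_mul, add_zero, Nat.cast_le]
      exact Finset.card_le_univ _
    | succ j ih =>
      intro hj
      have h1 := ih (by omega)
      have hc : ∀ r, ((ball r).card : ℝ) + (ball r)ᶜ.card = Fintype.card α := fun r => by
        exact_mod_cast Finset.card_add_card_compl (ball r)
      have hc1 := hc (R + j)
      have hc2 := hc (R + (j + 1))
      have h2 := hbdry (R + j) (by omega)
      have hsub : ball R ⊆ ball (R + j) := fun z hz => by
        rw [hmem] at hz ⊢
        omega
      have h3 := Finset.card_le_card hsub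
      have h4 : a * ((ball (R + j))ᶜ.card : ℝ)
          ≤ (F.interedges (ball (R + j)) (ball (R + j))ᶜ).card := by
        by_cases hem : (ball (R + j))ᶜ.Nonempty
        · have hcn := Finset.card_add_card_compl (ball (R + j))
          have h5 := hno _ hem (by omega)
          rw [compl_compl] at h5
          have : Std.Symm F.Adj := F.symm
          have h6 := Rel.card_interedges_comm (r := F.Adj) (ball (R + j)) (ball (R + j))ᶜ
          change (F.interedges _ _).card = (F.interedges _ _).card at h6
          rw [h6]
          exact h5.le
        · rw [Finset.not_nonempty_iff_eq_empty] at hem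
          rw [hem]
          simp
      have h7 : (1 + a) * ((ball (R + (j + 1)))ᶜ.card : ℝ) ≤ (ball (R + j))ᶜ.card := by
        have : ((ball (R + (j + 1)))ᶜ.card : ℝ) ≤ (1 - a) * (ball (R + j))ᶜ.card := by
          rw [← add_assoc] at hc2 ⊢
          linarith
        have h0 : (0 : ℝ) ≤ (ball (R + j))ᶜ.card := Nat.cast_nonneg _
        nlinarith [mul_nonneg (mul_nonneg ha.le ha.le) h0]
      calc (1 + a) ^ (j + 1) * ((ball (R + (j + 1)))ᶜ.card : ℝ)
          = (1 + a) ^ j * ((1 + a) * ((ball (R + (j + 1)))ᶜ.card : ℝ)) := by ring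
        _ ≤ (1 + a) ^ j * (ball (R + j))ᶜ.card := by gcongr
        _ ≤ _ := h1
  have hall : ∀ z, F.dist v z ≤ 2 * R := by
    have h1 := hshrink R le_rfl
    have h2 : (ball (R + R))ᶜ = ∅ := by
      rw [← Finset.card_eq_zero]
      by_contra! h0
      have h3 : (1 : ℝ) ≤ (ball (R + R))ᶜ.card := by exact_mod_cast Nat.one_le_iff_ne_zero.mpr h0
      have h4 : (0 : ℝ) < (1 + a) ^ R := by positivity
      nlinarith
    intro z
    have h3 : z ∈ ball (R + R) := by
      by_contra hz
      have := Finset.mem_compl.mpr hz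
      rw [h2] at this
      simp at this
    rw [hmem] at h3
    omega
  have hpar : ∀ u, ∃ x, (u = v → x = v) ∧
      (u ≠ v → F.Adj x u ∧ F.dist v x + 1 = F.dist v u) := by
    intro u
    by_cases huv : u = v
    · exact ⟨v, fun _ => rfl, fun h => absurd huv h⟩
    · obtain ⟨x, hx⟩ := exists_adj_dist_add_one hF huv
      exact ⟨x, fun h => absurd h huv, fun _ => hx⟩
  choose p hpv hp using hpar
  have hup : ∀ x y, F.Adj x y → F.dist v x ≤ F.dist v y → y ≠ v ∧ x = p y := by
    intro x y hxy hle
    have hyv : y ≠ v := by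
      rintro rfl
      rw [SimpleGraph.dist_self, Nat.le_zero, hF.dist_eq_zero_iff] at hle
      exact hxy.ne hle.symm
    have := hall y
    exact ⟨hyv, eq_of_adj_of_dist_le hF hg hxy (hp y hyv).1 hle (by have := (hp y hyv).2; omega)
      (by omega)⟩
  obtain ⟨B, h1, h2, h3⟩ := exists_sparse_cut_of_parent hΔ ha hm v p (F.dist v) (hpv v rfl)
    (fun x hx => by have := (hp x hx).2; omega) (fun x hx => (hp x hx).1) (by
      intro x y hxy
      rcases le_total (F.dist v x) (F.dist v y) with h | h
      · exact Or.inr (hup x y hxy h)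
      · exact Or.inl (hup y x hxy.symm h))
  exact absurd h3 (not_le.mpr (hno B h1 h2))

theorem card_hammingBall_le {d : ℕ} (x : Fin d → ZMod 2) (r : ℕ) :
    (Finset.univ.filter fun y => hammingDist x y ≤ r).card ≤ (d + 1) ^ r := by
  induction r with
  | zero =>
    rw [pow_zero, Finset.card_le_one]
    intro y hy z hz
    simp only [Finset.mem_filter, Finset.mem_univ, true_and, Nat.le_zero,
      hammingDist_eq_zero] at hy hz
    rw [← hy, hz]
  | succ r ih =>
    set S := Finset.univ.filter fun y => hammingDist x y ≤ r with hS
    let move : Option (Fin d) → (Fin d → ZMod 2) → (Fin d → ZMod 2) := fun o y =>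
      o.elim y fun i => Function.update y i (x i + 1)
    have hsub : (Finset.univ.filter fun y => hammingDist x y ≤ r + 1) ⊆
        Finset.univ.biUnion fun o => S.image (move o) := by
      intro y hy
      have hy : hammingDist x y ≤ r + 1 := by simpa using hy
      simp only [Finset.mem_biUnion, Finset.mem_univ, true_and, Finset.mem_image]
      by_cases hxy : ∃ i, x i ≠ y i
      · obtain ⟨i, hi⟩ := hxy
        refine ⟨some i, Function.update y i (x i), ?_, ?_⟩
        · have hlt : hammingDist x (Function.update y i (x i)) < hammingDist x y := by
            refine Finset.card_lt_card ?_
            rw [Finset.ssubset_iff_of_subset]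
            · exact ⟨i, by simpa using hi, by simp⟩
            · intro j hj
              by_cases hji : j = i
              · subst hji
                simp at hj
              · simpa [hji] using hj
          simp only [hS, Finset.mem_filter, Finset.mem_univ, true_and]
          omega
        · have h2 : ∀ a b : ZMod 2, a ≠ b → a + 1 = b := by decide
          simp [move, h2 _ _ hi]
      · have hxy : x = y := by
          funext i
          by_contra h
          exact hxy ⟨i, h⟩
        exact ⟨none, y, by simp [hS, hxy], rfl⟩
    refine (Finset.card_le_card hsub).trans (Finset.card_biUnion_le.trans ?_)
    calc ∑ o, (S.image (move o)).card ≤ ∑ _o : Option (Fin d), (d + 1) ^ r :=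
          Finset.sum_le_sum fun o _ => Finset.card_image_le.trans ih
      _ = (d + 1) ^ (r + 1) := by simp [pow_succ, mul_comm]

theorem two_mul_card_interedges_eq_sum {α : Type*} [Fintype α] [DecidableEq α]
    (K : SimpleGraph α) [DecidableRel K.Adj] (f : α → ZMod 2) :
    2 * (K.interedges (Finset.univ.filter fun x => f x = 0)
        (Finset.univ.filter fun x => f x = 0)ᶜ).card =
      ∑ u, ∑ v, if K.Adj u v ∧ f u ≠ f v then 1 else 0 := by
  have hcard : ∀ A B : Finset α, (K.interedges A B).card =
      ∑ u, ∑ v, if u ∈ A ∧ v ∈ B ∧ K.Adj u v then 1 else 0 := by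
    intro A B
    rw [← Finset.sum_product', Finset.univ_product_univ, ← Finset.card_filter]
    congr 1
    ext ⟨u, v⟩
    simp [mem_interedges_iff]
  set A := Finset.univ.filter fun x => f x = 0 with hA
  have : Std.Symm K.Adj := K.symm
  have hcomm : (K.interedges A Aᶜ).card = (K.interedges Aᶜ A).card :=
    Rel.card_interedges_comm (r := K.Adj) A Aᶜ
  rw [two_mul]
  nth_rewrite 2 [hcomm]
  rw [hcard, hcard, ← Finset.sum_add_distrib]
  refine Finset.sum_congr rfl fun u _ => ?_
  rw [← Finset.sum_add_distrib]
  refine Finset.sum_congr rfl fun v _ => ?_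
  simp only [hA, Finset.mem_compl, Finset.mem_filter, Finset.mem_univ, true_and]
  have h2 : ∀ a : ZMod 2, a = 0 ∨ a = 1 := by decide
  rcases h2 (f u) with hu | hu <;> rcases h2 (f v) with hv | hv <;>
    simp [hu, hv]

/-- A bounded degree graph with a map to the hypercube which has small fibers and sends edges to
edges has a coordinate cut of sparsity about `log d / log m`. -/
theorem exists_sparse_cut_of_hypercube {α : Type*} [Fintype α] [DecidableEq α] [Nonempty α]
    (K : SimpleGraph α) [DecidableRel K.Adj] {Δ d r : ℕ} (hΔ0 : 0 < Δ)
    (hΔ : ∀ x, K.degree x ≤ Δ) (f : α → Fin d → ZMod 2)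
    (hadj : ∀ x y, K.Adj x y → hammingDist (f x) (f y) = 1)
    (hfib : ∀ y, (Finset.univ.filter fun x => f x = y).card ≤ 2)
    (hr : 4 * (d + 1) ^ r ≤ Fintype.card α) :
    ∃ B : Finset α, B.Nonempty ∧ 2 * B.card ≤ Fintype.card α ∧
      (K.interedges B Bᶜ).card * (r + 1) ≤ 3 * Δ * B.card := by
  by_contra! hno
  set m := Fintype.card α with hm
  have hmpos : 0 < m := Fintype.card_pos
  set A : Fin d → Finset α := fun i => Finset.univ.filter fun x => f x i = 0 with hA
  have hE : ∑ i, 2 * (K.interedges (A i) (A i)ᶜ).card ≤ Δ * m := by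
    calc ∑ i, 2 * (K.interedges (A i) (A i)ᶜ).card
        = ∑ i, ∑ u, ∑ v, if K.Adj u v ∧ f u i ≠ f v i then 1 else 0 :=
          Finset.sum_congr rfl fun i _ => two_mul_card_interedges_eq_sum K fun x => f x i
      _ = ∑ u, ∑ v, ∑ i, if K.Adj u v ∧ f u i ≠ f v i then 1 else 0 := by
          rw [Finset.sum_comm]
          exact Finset.sum_congr rfl fun u _ => Finset.sum_comm
      _ ≤ ∑ u, ∑ v, if K.Adj u v then 1 else 0 := by
          refine Finset.sum_le_sum fun u _ => Finset.sum_le_sum fun v _ => ?_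
          split_ifs with h
          · simp only [h, true_and]
            rw [← Finset.card_filter]
            exact (hadj u v h).le
          · simp [h]
      _ = ∑ u, K.degree u := by
          refine Finset.sum_congr rfl fun u _ => ?_
          rw [← Finset.card_filter, ← card_neighborFinset_eq_degree, neighborFinset_eq_filter]
      _ ≤ ∑ _u : α, Δ := Finset.sum_le_sum fun u _ => hΔ u
      _ = Δ * m := by simp [hm, mul_comm]
  have hP : m * m * (r + 1) ≤ 2 * ∑ i, 2 * ((A i).card * (A i)ᶜ.card) := by
    have h1 : ∑ i, 2 * ((A i).card * (A i)ᶜ.card) = ∑ u, ∑ v, hammingDist (f u) (f v) := by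
      calc ∑ i, 2 * ((A i).card * (A i)ᶜ.card)
          = ∑ i, 2 * ((⊤ : SimpleGraph α).interedges (A i) (A i)ᶜ).card := by
            refine Finset.sum_congr rfl fun i _ => ?_
            rw [← Finset.card_product]
            congr 2
            ext ⟨u, v⟩
            simp only [Finset.mem_product, mem_interedges_iff, top_adj, Finset.mem_compl]
            constructor
            · rintro ⟨h1, h2⟩
              exact ⟨h1, h2, fun h => h2 (h ▸ h1)⟩
            · rintro ⟨h1, h2, -⟩
              exact ⟨h1, h2⟩
        _ = ∑ i, ∑ u, ∑ v, if (⊤ : SimpleGraph α).Adj u v ∧ f u i ≠ f v i then 1 else 0 :=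
            Finset.sum_congr rfl fun i _ => two_mul_card_interedges_eq_sum ⊤ fun x => f x i
        _ = ∑ u, ∑ v, ∑ i, if (⊤ : SimpleGraph α).Adj u v ∧ f u i ≠ f v i then 1 else 0 := by
            rw [Finset.sum_comm]
            exact Finset.sum_congr rfl fun u _ => Finset.sum_comm
        _ = _ := by
            refine Finset.sum_congr rfl fun u _ => Finset.sum_congr rfl fun v _ => ?_
            rw [← Finset.card_filter]
            unfold hammingDist
            congr 1
            ext i
            simp only [top_adj, Finset.mem_filter, Finset.mem_univ, true_and, and_iff_right_iff_imp]
            exact fun h huv => h (huv ▸ rfl)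
    have h2 : ∀ u, m * (r + 1) ≤ 2 * ∑ v, hammingDist (f u) (f v) := by
      intro u
      set N := Finset.univ.filter fun v => hammingDist (f u) (f v) ≤ r with hN
      have h3 : N.card ≤ (d + 1) ^ r * 2 := by
        have h4 := Finset.card_le_mul_card_image_of_maps_to (f := f) (s := N)
          (t := Finset.univ.filter fun y => hammingDist (f u) y ≤ r)
          (fun v hv => by simpa [hN] using hv) 2 (fun y _ =>
            (Finset.card_le_card (Finset.filter_subset_filter _ (Finset.subset_univ _))).trans
              (hfib y))
        have h5 := card_hammingBall_le (f u) r
        omega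
      have h4 := Finset.card_add_card_compl N
      have h5 : Nᶜ.card * (r + 1) ≤ ∑ v, hammingDist (f u) (f v) := by
        calc Nᶜ.card * (r + 1) = ∑ v ∈ Nᶜ, (r + 1) := by simp
          _ ≤ ∑ v ∈ Nᶜ, hammingDist (f u) (f v) := Finset.sum_le_sum fun v hv => by
              simp only [hN, Finset.mem_compl, Finset.mem_filter, Finset.mem_univ, true_and] at hv
              omega
          _ ≤ _ := Finset.sum_le_sum_of_subset (Finset.subset_univ _)
      calc m * (r + 1) ≤ (2 * Nᶜ.card) * (r + 1) := Nat.mul_le_mul_right _ (by omega)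
        _ ≤ _ := by rw [mul_assoc]; exact Nat.mul_le_mul_left 2 h5
    rw [h1, Finset.mul_sum]
    calc m * m * (r + 1) = ∑ _u : α, m * (r + 1) := by simp [hm, mul_assoc]
      _ ≤ _ := Finset.sum_le_sum fun u _ => h2 u
  have hstep : ∀ i, 3 * Δ * ((A i).card * (A i)ᶜ.card) ≤
      (K.interedges (A i) (A i)ᶜ).card * (r + 1) * m := by
    intro i
    have hc := Finset.card_add_card_compl (A i)
    have key : ∀ B : Finset α, 2 * B.card ≤ m →
        3 * Δ * B.card ≤ (K.interedges B Bᶜ).card * (r + 1) := by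
      intro B hB
      by_cases hne : B.Nonempty
      · exact (hno B hne hB).le
      · rw [Finset.not_nonempty_iff_eq_empty] at hne
        simp [hne]
    rcases le_total (A i).card (A i)ᶜ.card with h | h
    · have h1 := key (A i) (by omega)
      rw [← mul_assoc]
      exact Nat.mul_le_mul h1 (by omega)
    · have h1 := key (A i)ᶜ (by omega)
      have : Std.Symm K.Adj := K.symm
      have hcomm : (K.interedges (A i) (A i)ᶜ).card = (K.interedges (A i)ᶜ (A i)).card :=
        Rel.card_interedges_comm (r := K.Adj) _ _
      rw [compl_compl, ← hcomm] at h1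
      rw [mul_comm (A i).card, ← mul_assoc]
      exact Nat.mul_le_mul h1 (by omega)
  have hsum : 3 * Δ * ∑ i, 2 * ((A i).card * (A i)ᶜ.card) ≤
      (∑ i, 2 * (K.interedges (A i) (A i)ᶜ).card) * ((r + 1) * m) := by
    rw [Finset.mul_sum, Finset.sum_mul]
    refine Finset.sum_le_sum fun i _ => ?_
    have := hstep i
    nlinarith
  have h1 : 3 * Δ * (m * m * (r + 1)) ≤ 2 * (Δ * m * ((r + 1) * m)) := by
    calc 3 * Δ * (m * m * (r + 1))
        ≤ 3 * Δ * (2 * ∑ i, 2 * ((A i).card * (A i)ᶜ.card)) := Nat.mul_le_mul_left _ hP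
      _ = 2 * (3 * Δ * ∑ i, 2 * ((A i).card * (A i)ᶜ.card)) := by ring
      _ ≤ 2 * ((∑ i, 2 * (K.interedges (A i) (A i)ᶜ).card) * ((r + 1) * m)) :=
          Nat.mul_le_mul_left _ hsum
      _ ≤ _ := Nat.mul_le_mul_left _ (Nat.mul_le_mul_right _ hE)
  have h2 : 0 < Δ * (m * m * (r + 1)) := by positivity
  nlinarith

/-- The edges traversed by a walk in the hypercube that starts at a vertex and follows a list of
coordinate directions. -/
def cubeEdges {d : ℕ} : (Fin d → ZMod 2) → List (Fin d) → List (Sym2 (Fin d → ZMod 2))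
  | _, [] => []
  | x, i :: l => s(x, x + Pi.single i 1) :: cubeEdges (x + Pi.single i 1) l

theorem length_cubeEdges {d : ℕ} (x : Fin d → ZMod 2) (l : List (Fin d)) :
    (cubeEdges x l).length = l.length := by
  induction l generalizing x with
  | nil => rfl
  | cons i l ih => simp [cubeEdges, ih]

theorem exists_directions_of_walk {d : ℕ} {G : SimpleGraph (Fin d → ZMod 2)}
    (hG : ∀ x y, G.Adj x y → ∃ i, y = x + Pi.single i 1) {x y : Fin d → ZMod 2}
    (w : G.Walk x y) : ∃ l : List (Fin d), l.length = w.length ∧ cubeEdges x l = w.edges ∧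
      y = x + (l.map fun i => (Pi.single i 1 : Fin d → ZMod 2)).sum := by
  induction w with
  | nil => exact ⟨[], rfl, rfl, by simp⟩
  | @cons x z y h w ih =>
    obtain ⟨l, h1, h2, h3⟩ := ih
    obtain ⟨i, rfl⟩ := hG _ _ h
    exact ⟨i :: l, by simp [h1], by simp [cubeEdges, h2], by simp [h3, add_assoc]⟩

/-- Sequences of directions of closed walks of length `s` in the hypercube. -/
def closedSeq (d s : ℕ) : Finset (Fin s → Fin d) :=
  Finset.univ.filter fun f => ∑ i, (Pi.single (f i) 1 : Fin d → ZMod 2) = 0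

theorem card_closedSeq_zero (d : ℕ) : (closedSeq d 0).card = 1 := by
  simp [closedSeq]

theorem card_closedSeq_one (d : ℕ) : (closedSeq d 1).card = 0 := by
  simp [closedSeq]

theorem card_closedSeq_add_two_le (d s : ℕ) :
    (closedSeq d (s + 2)).card ≤ d * (s + 1) * (closedSeq d s).card := by
  have hsub : closedSeq d (s + 2) ⊆
      (Finset.univ : Finset (Fin d × Fin (s + 1))).biUnion fun p =>
        (closedSeq d s).image fun g =>
          (Fin.cons p.1 (p.2.insertNth p.1 g : Fin (s + 1) → Fin d) : Fin (s + 2) → Fin d) := by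
    intro f hf
    have hf : ∑ i, (Pi.single (f i) 1 : Fin d → ZMod 2) = 0 := (Finset.mem_filter.mp hf).2
    rw [Fin.sum_univ_succ] at hf
    obtain ⟨j, hj⟩ : ∃ j : Fin (s + 1), f j.succ = f 0 := by
      by_contra! hne
      have h1 := congrFun hf (f 0)
      rw [Pi.add_apply, Finset.sum_apply, Pi.single_eq_same, Finset.sum_eq_zero] at h1
      · simp at h1
      · exact fun j _ => Pi.single_eq_of_ne (hne j).symm 1
    have h2 : ∀ x : ZMod 2, x + x = 0 := by decide
    rw [Fin.sum_univ_succAbove _ j, hj, ← add_assoc] at hf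
    have h3 : (Pi.single (f 0) 1 + Pi.single (f 0) 1 : Fin d → ZMod 2) = 0 :=
      funext fun _ => h2 _
    rw [h3, zero_add] at hf
    refine Finset.mem_biUnion.mpr ⟨(f 0, j), Finset.mem_univ _, Finset.mem_image.mpr
      ⟨fun i => f (j.succAbove i).succ, Finset.mem_filter.mpr ⟨Finset.mem_univ _, hf⟩, ?_⟩⟩
    have h4 : (j.insertNth (f 0) fun i => f (j.succAbove i).succ : Fin (s + 1) → Fin d)
        = fun i => f i.succ := by
      rw [Fin.insertNth_eq_iff]
      exact ⟨hj.symm, rfl⟩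
    dsimp only
    rw [h4]
    exact Fin.cons_self_tail f
  refine (Finset.card_le_card hsub).trans (Finset.card_biUnion_le.trans ?_)
  refine (Finset.sum_le_card_nsmul _ _ _ fun p _ => Finset.card_image_le).trans ?_
  simp

/-- The weighted number of short closed walks, for walk weights decaying with the length. -/
theorem sum_card_closedSeq_mul_pow_le {d S : ℕ} {p : ℝ} (hp : 0 ≤ p)
    (h : ∀ s < S, 3 * ((s : ℝ) + 1) * d * p ^ 2 ≤ 1) :
    ∑ s ∈ Finset.range S, ((closedSeq d (s + 1)).card : ℝ) * p ^ (s + 1) ≤ 1 / 2 := by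
  set a : ℕ → ℝ := fun s => ((closedSeq d s).card : ℝ) * p ^ s with ha
  have hpos : ∀ s, 0 ≤ a s := fun s => by positivity
  have ha2 : ∀ s < S, a (s + 2) ≤ a s / 3 := by
    intro s hs
    have h1 : ((closedSeq d (s + 2)).card : ℝ) ≤ d * (s + 1) * (closedSeq d s).card := by
      exact_mod_cast card_closedSeq_add_two_le d s
    calc a (s + 2) ≤ (d * (s + 1) * (closedSeq d s).card) * p ^ (s + 2) := by
          simp only [ha]; gcongr
      _ = (3 * ((s : ℝ) + 1) * d * p ^ 2) * a s / 3 := by simp only [ha]; ring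
      _ ≤ 1 * a s / 3 := by
          have := h s hs
          have := hpos s
          gcongr
      _ = a s / 3 := by ring
  have key : ∀ T, T ≤ S →
      ∑ s ∈ Finset.range T, a (s + 1) + (3 / 2 * a (T + 1) + a T / 2) ≤ 1 / 2 := by
    intro T
    induction T with
    | zero => simp [ha, card_closedSeq_zero, card_closedSeq_one]
    | succ T ih =>
      intro hT
      have h1 := ih (by omega)
      have h2 := ha2 T (by omega)
      have h3 := hpos T
      rw [Finset.sum_range_succ]
      have h4 : a (T + 1 + 1) = a (T + 2) := rfl
      rw [h4]
      linarith
  have h1 := key S le_rfl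
  have h2 := hpos S
  have h3 := hpos (S + 1)
  simp only [ha] at h1 h2 h3
  linarith

theorem card_filter_forall_lt {E : Type*} [Fintype E] [DecidableEq E] {d q : ℕ} (hd : 0 < d)
    (hq : q ≤ d) (F : Finset E) :
    ((Finset.univ.filter fun c : E → Fin d => ∀ e ∈ F, (c e : ℕ) < q).card : ℝ) =
      (d : ℝ) ^ Fintype.card E * ((q : ℝ) / d) ^ F.card := by
  have h1 : (Finset.univ.filter fun c : E → Fin d => ∀ e ∈ F, (c e : ℕ) < q) =
      Fintype.piFinset fun e => if e ∈ F then Finset.univ.filter fun i : Fin d => (i : ℕ) < q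
        else Finset.univ := by
    ext c
    simp only [Finset.mem_filter, Finset.mem_univ, true_and, Fintype.mem_piFinset]
    refine forall_congr' fun e => ?_
    split_ifs with h <;> simp [h]
  have h2 : (Finset.univ.filter fun i : Fin d => (i : ℕ) < q).card = q := by
    rw [Fin.card_filter_val_lt]
    exact min_eq_right hq
  have h3 : ∀ e, (if e ∈ F then Finset.univ.filter fun i : Fin d => (i : ℕ) < q
      else Finset.univ).card = if e ∈ F then q else d := by
    intro e
    split_ifs
    · exact h2
    · simp
  have h4 := Finset.card_add_card_compl F
  have hd0 : (d : ℝ) ≠ 0 := by positivity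
  rw [h1, Fintype.card_piFinset]
  simp only [h3]
  rw [Finset.prod_ite, Finset.prod_const, Finset.prod_const]
  have h5 : (Finset.univ.filter fun e => e ∈ F) = F := by simp
  have h6 : (Finset.univ.filter fun e => e ∉ F) = Fᶜ := by ext; simp
  rw [h5, h6, ← h4, pow_add, div_pow]
  push_cast
  field_simp

theorem sum_card_sq_sub_le {E : Type*} [Fintype E] [DecidableEq E] {d q : ℕ} (hd : 0 < d)
    (hq : q ≤ d) (e : Fin d → E) (he : Function.Injective e) :
    ∑ c : E → Fin d, ((Finset.univ.filter fun i => (c (e i) : ℕ) < q).card : ℝ) =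
      (d : ℝ) ^ Fintype.card E * q ∧
    ∑ c : E → Fin d, (((Finset.univ.filter fun i => (c (e i) : ℕ) < q).card : ℝ) - q) ^ 2 ≤
      (d : ℝ) ^ Fintype.card E * q := by
  have hd0 : (d : ℝ) ≠ 0 := by positivity
  set M : ℝ := (d : ℝ) ^ Fintype.card E with hM
  have hMpos : 0 < M := by positivity
  have hX : ∀ c : E → Fin d, ((Finset.univ.filter fun i => (c (e i) : ℕ) < q).card : ℝ) =
      ∑ i, if (c (e i) : ℕ) < q then (1 : ℝ) else 0 := by
    intro c
    rw [Finset.card_filter]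
    push_cast
    rfl
  have hone : ∑ c : E → Fin d, ((Finset.univ.filter fun i => (c (e i) : ℕ) < q).card : ℝ) =
      M * q := by
    simp only [hX]
    rw [Finset.sum_comm]
    have h1 : ∀ i, ∑ c : E → Fin d, (if (c (e i) : ℕ) < q then (1 : ℝ) else 0) = M * (q / d) := by
      intro i
      have := card_filter_forall_lt hd hq ({e i} : Finset E)
      simp only [Finset.mem_singleton, forall_eq, Finset.card_singleton, pow_one] at this
      rw [← this, Finset.card_filter]
      push_cast
      rfl
    simp only [h1, Finset.sum_const, Finset.card_univ, Fintype.card_fin, nsmul_eq_mul]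
    field_simp
  have htwo : ∑ c : E → Fin d,
      ((Finset.univ.filter fun i => (c (e i) : ℕ) < q).card : ℝ) ^ 2 ≤ M * q + M * q ^ 2 := by
    have h0 : ∀ c : E → Fin d, ((Finset.univ.filter fun i => (c (e i) : ℕ) < q).card : ℝ) ^ 2 =
        ∑ i, ∑ j, if (c (e i) : ℕ) < q ∧ (c (e j) : ℕ) < q then (1 : ℝ) else 0 := by
      intro c
      rw [hX, sq, Finset.sum_mul_sum]
      refine Finset.sum_congr rfl fun i _ => Finset.sum_congr rfl fun j _ => ?_
      split_ifs <;> simp_all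
    simp only [h0]
    rw [Finset.sum_comm]
    have h1 : ∀ i j, ∑ c : E → Fin d,
        (if (c (e i) : ℕ) < q ∧ (c (e j) : ℕ) < q then (1 : ℝ) else 0) ≤
          M * (q / d) ^ 2 + if i = j then M * (q / d) else 0 := by
      intro i j
      have := card_filter_forall_lt hd hq ({e i, e j} : Finset E)
      have h2 : ∑ c : E → Fin d,
          (if (c (e i) : ℕ) < q ∧ (c (e j) : ℕ) < q then (1 : ℝ) else 0) =
            M * ((q : ℝ) / d) ^ ({e i, e j} : Finset E).card := by
        rw [← this, Finset.card_filter]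
        push_cast
        simp
      rw [h2]
      by_cases hij : i = j
      · subst hij
        simp only [Finset.pair_eq_singleton, Finset.card_singleton, pow_one, if_true]
        have : 0 ≤ M * ((q : ℝ) / d) ^ 2 := by positivity
        linarith
      · rw [Finset.card_pair (he.ne hij)]
        simp [hij]
    have h3 : ∀ i, ∑ c : E → Fin d, ∑ j,
        (if (c (e i) : ℕ) < q ∧ (c (e j) : ℕ) < q then (1 : ℝ) else 0) ≤
          ∑ j, (M * ((q : ℝ) / d) ^ 2 + if i = j then M * ((q : ℝ) / d) else 0) := by
      intro i
      rw [Finset.sum_comm]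
      exact Finset.sum_le_sum fun j _ => h1 i j
    refine (Finset.sum_le_sum fun i _ => h3 i).trans (le_of_eq ?_)
    simp only [Finset.sum_add_distrib, Finset.sum_const, Finset.card_univ, Fintype.card_fin,
      nsmul_eq_mul, Finset.sum_ite_eq, Finset.mem_univ, if_true]
    field_simp
    ring
  refine ⟨hone, ?_⟩
  have hcard : ∑ _c : E → Fin d, (q : ℝ) ^ 2 = M * q ^ 2 := by
    simp [hM]
  have hexp : ∑ c : E → Fin d,
      (((Finset.univ.filter fun i => (c (e i) : ℕ) < q).card : ℝ) - q) ^ 2 =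
      ∑ c : E → Fin d, ((Finset.univ.filter fun i => (c (e i) : ℕ) < q).card : ℝ) ^ 2
        - 2 * q * ∑ c : E → Fin d, ((Finset.univ.filter fun i => (c (e i) : ℕ) < q).card : ℝ)
        + ∑ _c : E → Fin d, (q : ℝ) ^ 2 := by
    rw [Finset.mul_sum, ← Finset.sum_sub_distrib, ← Finset.sum_add_distrib]
    exact Finset.sum_congr rfl fun c _ => by ring
  rw [hexp, hone, hcard]
  linarith

/-- There is a subgraph of the hypercube with many edges, small degrees and large girth. -/
theorem exists_sparse_hypercube_subgraph (d k : ℕ) (hk : 2 ≤ k) (hkd : 3 * k ≤ d) :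
    ∃ G : SimpleGraph (Fin d → ZMod 2),
      (∀ x y, G.Adj x y → ∃ i, y = x + Pi.single i 1) ∧
      k * 2 ^ d ≤ G.edgeSet.ncard ∧
      (∀ x, (G.neighborSet x).ncard ≤ 6 * k) ∧
      ∀ (x : Fin d → ZMod 2) (w : G.Walk x x), w.IsCycle → d < 36 * k ^ 2 * w.length := by
  classical
  set X := Fin d → ZMod 2 with hX
  have hd : 0 < d := by omega
  have hd0 : (0 : ℝ) < d := by positivity
  set q := 3 * k with hq
  set S := d / (36 * k ^ 2) with hS
  set M : ℝ := (d : ℝ) ^ Fintype.card (Sym2 X) with hM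
  have hMpos : 0 < M := by positivity
  set N : ℝ := 2 ^ d with hN
  have hNpos : 0 < N := by positivity
  have hcardX : ((Finset.univ : Finset X).card : ℝ) = N := by simp [hX, hN]
  set e : X → Fin d → Sym2 X := fun x i => s(x, x + Pi.single i 1) with he
  have hsingle : ∀ i j : Fin d, (Pi.single i 1 : X) = Pi.single j 1 → i = j := by
    intro i j hij
    by_contra hne
    have := congrFun hij i
    rw [Pi.single_eq_same, Pi.single_eq_of_ne hne] at this
    exact one_ne_zero this
  have hne : ∀ (x : X) i, x ≠ x + Pi.single i 1 := by
    intro x i h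
    have := congrFun (left_eq_add.mp h) i
    simp at this
  have heinj : ∀ x, Function.Injective (e x) := by
    intro x i j hij
    rcases Sym2.eq_iff.mp hij with ⟨-, h⟩ | ⟨h, -⟩
    · exact hsingle i j (add_left_cancel h)
    · exact absurd h (hne x j)
  let dirs : (Sym2 X → Fin d) → X → Finset (Fin d) := fun c x =>
    Finset.univ.filter fun i => (c (e x i) : ℕ) < q
  let bad : (Sym2 X → Fin d) → (s : ℕ) → Finset (X × (Fin (s + 1) → Fin d)) := fun c s =>
    Finset.univ.filter fun t => t.2 ∈ closedSeq d (s + 1) ∧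
      (cubeEdges t.1 (List.ofFn t.2)).Nodup ∧ ∀ a ∈ cubeEdges t.1 (List.ofFn t.2), (c a : ℕ) < q
  have hexc : ∀ x, ∑ c, (((dirs c x).card - 6 * k : ℕ) : ℝ) ≤ M / 4 := by
    intro x
    have h1 := (sum_card_sq_sub_le hd hkd (e x) (heinj x)).2
    have hk0 : (0 : ℝ) < k := by positivity
    have h2 : ∀ c, 12 * (k : ℝ) * (((dirs c x).card - 6 * k : ℕ) : ℝ) ≤
        (((dirs c x).card : ℝ) - (3 * k : ℕ)) ^ 2 := by
      intro c
      rcases le_total (6 * k) (dirs c x).card with h | h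
      · rw [Nat.cast_sub h]
        push_cast
        nlinarith [sq_nonneg (((dirs c x).card : ℝ) - 9 * k)]
      · rw [Nat.sub_eq_zero_of_le h]
        simpa using sq_nonneg _
    have h3 : 12 * (k : ℝ) * ∑ c, (((dirs c x).card - 6 * k : ℕ) : ℝ) ≤ M * (3 * k : ℕ) := by
      rw [Finset.mul_sum]
      exact (Finset.sum_le_sum fun c _ => h2 c).trans h1
    push_cast at h3
    by_contra! hlt
    nlinarith
  have hbad : ∑ c, ∑ s ∈ Finset.range S, ((bad c s).card : ℝ) ≤ M * N / 2 := by
    rw [Finset.sum_comm]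
    have h1 : ∀ s, ∑ c, ((bad c s).card : ℝ) ≤
        M * N * (((closedSeq d (s + 1)).card : ℝ) * ((q : ℝ) / d) ^ (s + 1)) := by
      intro s
      have h2 : ∀ c, ((bad c s).card : ℝ) = ∑ t : X × (Fin (s + 1) → Fin d),
          if t.2 ∈ closedSeq d (s + 1) ∧ (cubeEdges t.1 (List.ofFn t.2)).Nodup ∧
            ∀ a ∈ cubeEdges t.1 (List.ofFn t.2), (c a : ℕ) < q then (1 : ℝ) else 0 := by
        intro c
        simp only [bad, Finset.card_filter]
        push_cast
        rfl
      simp only [h2]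
      rw [Finset.sum_comm]
      have h3 : ∀ t : X × (Fin (s + 1) → Fin d), ∑ c : Sym2 X → Fin d,
          (if t.2 ∈ closedSeq d (s + 1) ∧ (cubeEdges t.1 (List.ofFn t.2)).Nodup ∧
            ∀ a ∈ cubeEdges t.1 (List.ofFn t.2), (c a : ℕ) < q then (1 : ℝ) else 0) ≤
          if t.2 ∈ closedSeq d (s + 1) then M * ((q : ℝ) / d) ^ (s + 1) else 0 := by
        intro t
        by_cases ht : t.2 ∈ closedSeq d (s + 1) ∧ (cubeEdges t.1 (List.ofFn t.2)).Nodup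
        · have h4 := card_filter_forall_lt hd hkd (cubeEdges t.1 (List.ofFn t.2)).toFinset
          rw [List.toFinset_card_of_nodup ht.2, length_cubeEdges, List.length_ofFn,
            Finset.card_filter] at h4
          simp only [List.mem_toFinset] at h4
          push_cast at h4
          simp only [ht.1, ht.2, true_and, if_true]
          exact h4.le
        · have h5 : ∀ c : Sym2 X → Fin d, ¬ (t.2 ∈ closedSeq d (s + 1) ∧
              (cubeEdges t.1 (List.ofFn t.2)).Nodup ∧
              ∀ a ∈ cubeEdges t.1 (List.ofFn t.2), (c a : ℕ) < q) :=
            fun c h => ht ⟨h.1, h.2.1⟩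
          simp only [h5, if_false, Finset.sum_const_zero]
          positivity
      refine (Finset.sum_le_sum fun t _ => h3 t).trans (le_of_eq ?_)
      rw [← Finset.univ_product_univ, Finset.sum_product]
      simp only [Finset.sum_ite_mem, Finset.univ_inter, Finset.sum_const, nsmul_eq_mul, hcardX]
      ring
    calc ∑ s ∈ Finset.range S, ∑ c, ((bad c s).card : ℝ)
        ≤ ∑ s ∈ Finset.range S,
          M * N * (((closedSeq d (s + 1)).card : ℝ) * ((q : ℝ) / d) ^ (s + 1)) :=
          Finset.sum_le_sum fun s _ => h1 s
      _ ≤ M * N * (1 / 2) := by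
          rw [← Finset.mul_sum]
          refine mul_le_mul_of_nonneg_left (sum_card_closedSeq_mul_pow_le (by positivity) ?_)
            (by positivity)
          intro s hs
          have h2 : 36 * k ^ 2 * (s + 1) ≤ d :=
            (Nat.mul_le_mul_left _ hs).trans (Nat.mul_div_le d _)
          have h3 : 36 * (k : ℝ) ^ 2 * (s + 1) ≤ d := by exact_mod_cast h2
          have h4 : 3 * ((s : ℝ) + 1) * d * ((q : ℝ) / d) ^ 2 =
              27 * (k : ℝ) ^ 2 * (s + 1) / d := by
            simp only [hq]
            push_cast
            field_simp
            ring
          rw [h4, div_le_one hd0]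
          have : 0 ≤ (k : ℝ) ^ 2 * (s + 1) := by positivity
          linarith
      _ = M * N / 2 := by ring
  have hdeg : ∑ c, ∑ x, ((dirs c x).card : ℝ) = M * N * (3 * k) := by
    rw [Finset.sum_comm]
    have h1 : ∀ x, ∑ c, ((dirs c x).card : ℝ) = M * (3 * k : ℕ) :=
      fun x => (sum_card_sq_sub_le hd hkd (e x) (heinj x)).1
    simp only [h1, Finset.sum_const, nsmul_eq_mul, hcardX]
    push_cast
    ring
  have hexcsum : ∑ c, ∑ x, (((dirs c x).card - 6 * k : ℕ) : ℝ) ≤ M * N / 4 := by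
    rw [Finset.sum_comm]
    refine (Finset.sum_le_sum fun x _ => hexc x).trans (le_of_eq ?_)
    rw [Finset.sum_const, nsmul_eq_mul, hcardX]
    ring
  obtain ⟨c, hc⟩ : ∃ c, N * k ≤ (∑ x, ((dirs c x).card : ℝ)) / 2 -
      ∑ x, (((dirs c x).card - 6 * k : ℕ) : ℝ) - ∑ s ∈ Finset.range S, ((bad c s).card : ℝ) := by
    have hnonempty : (Finset.univ : Finset (Sym2 X → Fin d)).Nonempty :=
      ⟨fun _ => ⟨0, hd⟩, Finset.mem_univ _⟩
    obtain ⟨c, -, hc⟩ := Finset.exists_le_of_sum_le hnonempty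
      (f := fun _ => N * k) (g := fun c => (∑ x, ((dirs c x).card : ℝ)) / 2 -
        ∑ x, (((dirs c x).card - 6 * k : ℕ) : ℝ) - ∑ s ∈ Finset.range S, ((bad c s).card : ℝ)) (by
        rw [Finset.sum_sub_distrib, Finset.sum_sub_distrib, ← Finset.sum_div, hdeg,
          Finset.sum_const, nsmul_eq_mul, Finset.card_univ, Fintype.card_fun, Fintype.card_fin]
        push_cast
        change M * (N * k) ≤ _
        have h2 : (2 : ℝ) ≤ k := by exact_mod_cast hk
        have h3 : 0 < M * N := by positivity
        nlinarith)
    exact ⟨c, hc⟩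
  let G₀ : SimpleGraph X :=
    { Adj := fun x y => (∃ i, y = x + Pi.single i 1) ∧ (c s(x, y) : ℕ) < q
      symm := ⟨by
        rintro x y ⟨⟨i, rfl⟩, h⟩
        refine ⟨⟨i, ?_⟩, by rwa [Sym2.eq_swap]⟩
        have h2 : ∀ a : ZMod 2, a + a = 0 := by decide
        have h3 : (Pi.single i 1 + Pi.single i 1 : X) = 0 := funext fun _ => h2 _
        rw [add_assoc, h3, add_zero]⟩
      loopless := ⟨by
        rintro x ⟨⟨i, h⟩, -⟩
        exact hne x i h⟩ }
  have hT : ∀ x, ∃ T ⊆ dirs c x, T.card = (dirs c x).card - 6 * k := fun x =>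
    Finset.exists_subset_card_eq (Nat.sub_le _ _)
  choose T hTsub hTcard using hT
  set D₁ : Finset (Sym2 X) := Finset.univ.biUnion fun x => (T x).image (e x) with hD₁
  set D₂ : Finset (Sym2 X) := (Finset.range S).biUnion fun s =>
    (bad c s).image fun t => e t.1 (t.2 0) with hD₂
  have hD₁card : D₁.card ≤ ∑ x, ((dirs c x).card - 6 * k) :=
    Finset.card_biUnion_le.trans (Finset.sum_le_sum fun x _ =>
      Finset.card_image_le.trans (hTcard x).le)
  have hD₂card : D₂.card ≤ ∑ s ∈ Finset.range S, (bad c s).card :=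
    Finset.card_biUnion_le.trans (Finset.sum_le_sum fun s _ => Finset.card_image_le)
  have hG₀ : ∀ x y, G₀.Adj x y → ∃ i, y = x + Pi.single i 1 := fun x y h => h.1
  have hdeg₀ : ∀ x, G₀.degree x = (dirs c x).card := by
    intro x
    have : G₀.neighborFinset x = (dirs c x).image fun i => x + Pi.single i 1 := by
      ext y
      simp only [mem_neighborFinset, Finset.mem_image, dirs, Finset.mem_filter, Finset.mem_univ,
        true_and]
      constructor
      · rintro ⟨⟨i, rfl⟩, h⟩
        exact ⟨i, h, rfl⟩
      · rintro ⟨i, h, rfl⟩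
        exact ⟨⟨i, rfl⟩, h⟩
    rw [← card_neighborFinset_eq_degree, this, Finset.card_image_of_injective]
    exact fun i j h => hsingle i j (add_left_cancel h)
  refine ⟨G₀.deleteEdges (D₁ ∪ D₂ : Finset (Sym2 X)), ?_, ?_, ?_, ?_⟩
  · intro x y h
    exact hG₀ x y (deleteEdges_le _ h)
  · rw [edgeSet_deleteEdges]
    have h1 := G₀.sum_degrees_eq_twice_card_edges
    simp only [hdeg₀] at h1
    have h2 : G₀.edgeSet.ncard = G₀.edgeFinset.card := by
      rw [← coe_edgeFinset, Set.ncard_coe_finset]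
    have h3 := Set.le_ncard_sdiff ((D₁ ∪ D₂ : Finset (Sym2 X)) : Set (Sym2 X)) G₀.edgeSet
      (Finset.finite_toSet _)
    rw [Set.ncard_coe_finset, h2] at h3
    have h4 := Finset.card_union_le D₁ D₂
    have h5 : (∑ x, ((dirs c x).card : ℝ)) = 2 * G₀.edgeFinset.card := by exact_mod_cast h1
    have h6 : (D₁.card : ℝ) ≤ ∑ x, (((dirs c x).card - 6 * k : ℕ) : ℝ) := by
      exact_mod_cast hD₁card
    have h7 : (D₂.card : ℝ) ≤ ∑ s ∈ Finset.range S, ((bad c s).card : ℝ) := by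
      exact_mod_cast hD₂card
    have h8 : k * 2 ^ d + D₁.card + D₂.card ≤ G₀.edgeFinset.card := by
      have : (k : ℝ) * 2 ^ d + D₁.card + D₂.card ≤ G₀.edgeFinset.card := by
        rw [h5] at hc
        rw [mul_comm (k : ℝ)]
        linarith
      exact_mod_cast this
    omega
  · intro x
    have h1 : (G₀.deleteEdges (D₁ ∪ D₂ : Finset (Sym2 X))).neighborSet x ⊆
        (((dirs c x) \ T x).image fun i => x + Pi.single i 1 : Finset X) := by
      intro y hy
      rw [mem_neighborSet, deleteEdges_adj] at hy
      obtain ⟨⟨⟨i, rfl⟩, h⟩, hn⟩ := hy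
      rw [Finset.coe_image]
      refine ⟨i, Finset.mem_coe.mpr (Finset.mem_sdiff.mpr
        ⟨Finset.mem_filter.mpr ⟨Finset.mem_univ _, h⟩, fun hi => hn ?_⟩), rfl⟩
      exact Finset.mem_coe.mpr (Finset.mem_union_left _ (Finset.mem_biUnion.mpr
        ⟨x, Finset.mem_univ _, Finset.mem_image_of_mem (e x) hi⟩))
    refine (Set.ncard_le_ncard h1 (Finset.finite_toSet _)).trans ?_
    rw [Set.ncard_coe_finset]
    refine Finset.card_image_le.trans ?_
    rw [Finset.card_sdiff_of_subset (hTsub x), hTcard x]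
    omega
  · intro x w hw
    by_contra! hlen
    obtain ⟨l, hl1, hl2, hl3⟩ := exists_directions_of_walk
      (fun x y h => hG₀ x y (deleteEdges_le _ h)) w
    have hsum := (left_eq_add.mp hl3)
    have h3 := hw.three_le_length
    obtain ⟨s, hs⟩ : ∃ s, l.length = s + 1 := ⟨l.length - 1, by omega⟩
    have hsS : s < S := by
      have : s + 1 ≤ S := by
        rw [hS, Nat.le_div_iff_mul_le (by positivity)]
        rw [← hs, hl1, mul_comm]
        exact hlen
      omega
    have key : ∀ n, l.length = n → ∃ f : Fin n → Fin d, List.ofFn f = l := by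
      rintro _ rfl
      exact ⟨l.get, List.ofFn_get l⟩
    obtain ⟨f, rfl⟩ := key _ hs
    rw [List.map_ofFn, List.sum_ofFn] at hsum
    have hmem : (x, f) ∈ bad c s := by
      refine Finset.mem_filter.mpr ⟨Finset.mem_univ _,
        Finset.mem_filter.mpr ⟨Finset.mem_univ _, hsum⟩, ?_, ?_⟩
      · rw [hl2]
        exact hw.isTrail.edges_nodup
      · intro a ha
        rw [hl2] at ha
        have := w.edges_subset_edgeSet ha
        rw [edgeSet_deleteEdges] at this
        have h5 := this.1
        induction a with
        | _ y z => exact h5.2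
    have hfirst : e x (f 0) ∈ w.edges := by
      rw [← hl2, List.ofFn_succ]
      exact List.mem_cons_self
    have h4 := w.edges_subset_edgeSet hfirst
    rw [edgeSet_deleteEdges] at h4
    refine h4.2 (Finset.mem_coe.mpr (Finset.mem_union_right _ (Finset.mem_biUnion.mpr
      ⟨s, Finset.mem_range.mpr hsS, ?_⟩)))
    exact Finset.mem_image.mpr ⟨(x, f), hmem, rfl⟩

/-- A homomorphism which is injective on the non-isolated vertices preserves cycles. -/
theorem isCycle_map_of_leftInverse {V W : Type*} {G : SimpleGraph V} {G' : SimpleGraph W}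
    (φ : G →g G') (ι : W → V) (h : ∀ x y, G.Adj x y → ι (φ x) = x) {v : V} {w : G.Walk v v}
    (hw : w.IsCycle) : (w.map φ).IsCycle := by
  have htail : ∀ {a b : V} (p : G.Walk a b), ∀ x ∈ p.support.tail, ι (φ x) = x := by
    intro a b p
    induction p with
    | nil => simp
    | @cons a b c hab p ih =>
      intro x hx
      rw [Walk.support_cons, List.tail_cons, ← Walk.cons_tail_support] at hx
      rcases List.mem_cons.mp hx with rfl | hx
      · exact h _ _ hab.symm
      · exact ih x hx
  rw [Walk.isCycle_def]
  refine ⟨⟨?_⟩, ?_, ?_⟩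
  · rw [Walk.edges_map]
    have hedge : ∀ e ∈ w.edges, Sym2.map ι (Sym2.map φ e) = e := by
      intro e he
      have := w.edges_subset_edgeSet he
      induction e with
      | _ x y => exact congrArg₂ (fun a b => s(a, b)) (h x y this) (h y x this.symm)
    exact hw.isTrail.edges_nodup.map_on fun a ha b hb hab => by
      rw [← hedge a ha, ← hedge b hb, hab]
  · intro h0
    have h1 := congrArg Walk.length h0
    have h2 := hw.three_le_length
    rw [Walk.length_map, Walk.length_nil] at h1
    omega
  · rw [Walk.support_map, ← List.map_tail]
    exact hw.support_nodup.map_on fun a ha b hb hab => by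
      rw [← htail w a ha, ← htail w b hb, hab]

/-- A type `X` embeds in `Fin n`, for `|X| ≤ n ≤ 2 |X|`, with a retraction that is at most
two-to-one. -/
theorem exists_embedding_fin_retraction {X : Type*} [Fintype X] [DecidableEq X] {n : ℕ}
    (h1 : Fintype.card X ≤ n) (h2 : n ≤ 2 * Fintype.card X) :
    ∃ (ι : X ↪ Fin n) (ψ : Fin n → X), (∀ x, ψ (ι x) = x) ∧
      ∀ y, (Finset.univ.filter fun i => ψ i = y).card ≤ 2 := by
  let e := Fintype.equivFin X
  set N := Fintype.card X with hN
  have hpos : ∀ _ : Fin n, 0 < N := fun i => by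
    have := i.2
    omega
  refine ⟨⟨fun x => (e x).castLE h1, fun x y hxy => e.injective (Fin.castLE_injective h1 hxy)⟩,
    fun i => e.symm ⟨i % N, Nat.mod_lt _ (hpos i)⟩, fun x => ?_, fun y => ?_⟩
  · rw [Equiv.symm_apply_eq]
    ext
    exact Nat.mod_eq_of_lt (e x).2
  · have h3 : ((Finset.univ.filter fun i : Fin n =>
        e.symm ⟨i % N, Nat.mod_lt _ (hpos i)⟩ = y).image fun i : Fin n => (i : ℕ)) ⊆
        {(e y : ℕ), (e y : ℕ) + N} := by
      intro j hj
      obtain ⟨i, hi, rfl⟩ := Finset.mem_image.mp hj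
      have h4 := (Equiv.symm_apply_eq _).mp (Finset.mem_filter.mp hi).2
      have h5 : (i : ℕ) % N = e y := congrArg Fin.val h4
      have h6 := Nat.div_add_mod (i : ℕ) N
      have h7 : (i : ℕ) / N < 2 := by
        rw [Nat.div_lt_iff_lt_mul (hpos i)]
        exact lt_of_lt_of_le i.2 h2
      simp only [Finset.mem_insert, Finset.mem_singleton]
      interval_cases hq : (i : ℕ) / N <;> omega
    rw [← Finset.card_image_of_injective _ Fin.val_injective]
    exact (Finset.card_le_card h3).trans Finset.card_le_two

/-- A graph on `n` vertices with many edges, small degrees and large girth, which maps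
homomorphically and at most two-to-one to the hypercube of dimension `⌊log n⌋`. -/
theorem exists_sparse_graph_fin {n k : ℕ} (hn : n ≠ 0) (hk : 2 ≤ k)
    (hkd : 3 * k ≤ Nat.log 2 n) :
    ∃ (G : SimpleGraph (Fin n)) (f : Fin n → Fin (Nat.log 2 n) → ZMod 2),
      k * n ≤ 2 * G.edgeSet.ncard ∧
      (∀ v, (G.neighborSet v).ncard ≤ 6 * k) ∧
      (∀ (v : Fin n) (w : G.Walk v v), w.IsCycle → Nat.log 2 n < 36 * k ^ 2 * w.length) ∧
      (∀ x y, G.Adj x y → hammingDist (f x) (f y) = 1) ∧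
      ∀ y, (Finset.univ.filter fun x => f x = y).card ≤ 2 := by
  set d := Nat.log 2 n with hd
  obtain ⟨G', hcube, hedges, hdeg, hgirth⟩ := exists_sparse_hypercube_subgraph d k hk hkd
  have h1 : 2 ^ d ≤ n := Nat.pow_log_le_self 2 hn
  have h2 : n < 2 ^ (d + 1) := Nat.lt_pow_succ_log_self one_lt_two n
  rw [pow_succ] at h2
  have hcard : Fintype.card (Fin d → ZMod 2) = 2 ^ d := by simp
  obtain ⟨ι, ψ, hψ, hfib⟩ := exists_embedding_fin_retraction (X := Fin d → ZMod 2) (n := n)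
    (by rw [hcard]; exact h1) (by rw [hcard]; omega)
  have hhom : ∀ x y, (G'.map ι).Adj x y → G'.Adj (ψ x) (ψ y) := by
    intro x y hxy
    obtain ⟨-, a, b, hab, rfl, rfl⟩ := hxy
    rwa [hψ, hψ]
  refine ⟨G'.map ι, ψ, ?_, ?_, ?_, ?_, hfib⟩
  · rw [edgeSet_map, Set.ncard_image_of_injective _ (Function.Embedding.injective _)]
    calc k * n ≤ k * (2 ^ d * 2) := Nat.mul_le_mul_left _ h2.le
      _ = 2 * (k * 2 ^ d) := by ring
      _ ≤ _ := Nat.mul_le_mul_left _ hedges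
  · intro v
    have hsub : (G'.map ι).neighborSet v ⊆ ι '' G'.neighborSet (ψ v) := by
      rintro y ⟨-, a, b, hab, rfl, rfl⟩
      exact ⟨b, by rwa [hψ], rfl⟩
    exact (Set.ncard_le_ncard hsub (Set.toFinite _)).trans
      ((Set.ncard_image_le (Set.toFinite _)).trans (hdeg _))
  · intro v w hw
    have h3 := hgirth _ _ (isCycle_map_of_leftInverse (⟨ψ, hhom _ _⟩ : G'.map ι →g G') ι (by
      rintro x y ⟨-, a, b, hab, rfl, rfl⟩
      exact congrArg ι (hψ a)) hw)
    rwa [Walk.length_map] at h3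
  · intro x y hxy
    obtain ⟨i, hi⟩ := hcube _ _ (hhom x y hxy)
    rw [hi, hammingDist]
    have : (Finset.univ.filter fun j => ψ x j ≠ (ψ x + Pi.single i 1 : Fin d → ZMod 2) j) =
        {i} := by
      ext j
      by_cases hji : j = i
      · subst hji
        simp
      · simp [hji]
    rw [this, Finset.card_singleton]

theorem sq_le_two_rpow {x : ℝ} (hx : 6 ≤ x) : x ^ 2 ≤ 2 ^ x := by
  have hn : 6 ≤ ⌊x⌋₊ := Nat.le_floor hx
  have key : ∀ n : ℕ, 6 ≤ n → (n + 1) ^ 2 ≤ 2 ^ n := by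
    intro n hn
    induction n, hn using Nat.le_induction with
    | base => norm_num
    | succ n hn ih =>
      rw [pow_succ 2]
      nlinarith
  calc x ^ 2 ≤ ((⌊x⌋₊ : ℝ) + 1) ^ 2 := by
        gcongr
        exact (Nat.lt_floor_add_one x).le
    _ ≤ 2 ^ ⌊x⌋₊ := by exact_mod_cast key _ hn
    _ ≤ 2 ^ x := by
        rw [← Real.rpow_natCast]
        exact Real.rpow_le_rpow_of_exponent_le one_le_two (Nat.floor_le (by linarith))

/-- Elementary bounds for a number `L` whose logarithm is at least `648 k`. -/
theorem bounds_of_le_logb {L : ℝ} {k : ℕ} (hk : 2 ≤ k) (hL0 : 0 < L)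
    (hL : 648 * (k : ℝ) ≤ Real.logb 2 L) :
    (576 * (k : ℝ) ^ 2) ^ 2 ≤ L ∧
      ∀ t : ℝ, L / (6 * k) ^ 2 ≤ t → Real.logb 2 L - 5 * k ≤ Real.logb 2 t := by
  have hk' : (2 : ℝ) ≤ k := by exact_mod_cast hk
  have hk0 : (0 : ℝ) < k := by linarith
  have hpow : (k : ℝ) ≤ 2 ^ k := by exact_mod_cast Nat.lt_two_pow_self.le
  have hsq : (k : ℝ) ^ 2 ≤ 2 ^ (2 * k) := by
    rw [mul_comm, pow_mul]
    gcongr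
  constructor
  · have h1 : (2 : ℝ) ^ (648 * (k : ℝ)) ≤ L :=
      (Real.le_logb_iff_rpow_le one_lt_two hL0).mp hL
    have h2 : (2 : ℝ) ^ (648 * (k : ℝ)) = 2 ^ (648 * k) := by
      rw [← Real.rpow_natCast]
      push_cast
      rfl
    rw [h2] at h1
    refine le_trans ?_ h1
    calc (576 * (k : ℝ) ^ 2) ^ 2 ≤ (2 ^ 10 * 2 ^ (2 * k)) ^ 2 := by
          gcongr
          norm_num
      _ = 2 ^ (20 + 4 * k) := by ring
      _ ≤ 2 ^ (648 * k) := pow_le_pow_right₀ one_le_two (by omega)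
  · intro t ht
    have h0 : 0 < L / (6 * (k : ℝ)) ^ 2 := by positivity
    refine le_trans ?_ (Real.logb_le_logb_of_le one_lt_two h0 ht)
    rw [Real.logb_div hL0.ne' (by positivity)]
    have : Real.logb 2 ((6 * (k : ℝ)) ^ 2) ≤ 5 * k := by
      rw [Real.logb_le_iff_le_rpow one_lt_two (by positivity)]
      have h2 : (2 : ℝ) ^ (5 * (k : ℝ)) = 2 ^ (5 * k) := by
        rw [← Real.rpow_natCast]
        push_cast
        rfl
      rw [h2]
      calc (6 * (k : ℝ)) ^ 2 = 36 * (k : ℝ) ^ 2 := by ring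
        _ ≤ 2 ^ 6 * 2 ^ (2 * k) := by
          gcongr
          norm_num
        _ = 2 ^ (6 + 2 * k) := by ring
        _ ≤ 2 ^ (5 * k) := pow_le_pow_right₀ one_le_two (by omega)
    linarith

theorem mul_le_sq_mul_sub_three {k l u T : ℝ} (hk : 648 * k ≤ u) (hu : 9 ≤ u) (hT : 30 ≤ T)
    (hul : u ≤ 4 * l) : 18 * k * (T * (u + 1)) ≤ l ^ 2 * (T - 3) := by
  have h0 : 0 ≤ T * u ^ 2 := by positivity
  calc 18 * k * (T * (u + 1)) ≤ u / 36 * (T * (10 / 9 * u)) := by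
        gcongr <;> linarith
    _ ≤ (u / 4) ^ 2 * (9 / 10 * T) := by linarith
    _ ≤ l ^ 2 * (T - 3) := by
        gcongr <;> linarith

/-- A graph of small degree and large girth which maps at most two-to-one to the hypercube has a
sparse cut. -/
theorem exists_sparse_cut {α : Type*} [Fintype α] [DecidableEq α] (K : SimpleGraph α)
    [DecidableRel K.Adj] {d k t : ℕ} {L : ℝ} (hk : 2 ≤ k) (hL0 : 0 < L)
    (hL : 648 * (k : ℝ) ≤ Real.logb 2 L) (hd : (d : ℝ) ≤ L)
    (hdeg : ∀ x, K.degree x ≤ 6 * k)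
    (hcyc : ∀ v (w : K.Walk v v), w.IsCycle → L / (6 * k : ℝ) ^ 2 ≤ w.length)
    (f : α → Fin d → ZMod 2) (hadj : ∀ x y, K.Adj x y → hammingDist (f x) (f y) = 1)
    (hfib : ∀ y, (Finset.univ.filter fun x => f x = y).card ≤ 2)
    (ht : L / (6 * k : ℝ) ^ 2 ≤ t) (hm1 : Fintype.card α ≤ t) (hm2 : 2 * t < 3 * Fintype.card α) :
    ∃ B : Finset α, B.Nonempty ∧ 2 * B.card ≤ Fintype.card α ∧
      ((K.interedges B Bᶜ).card : ℝ) ≤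
        (Real.logb 2 (Real.logb 2 t)) ^ 2 / Real.logb 2 t * B.card := by
  obtain ⟨hL1, hL2⟩ := bounds_of_le_logb hk hL0 hL
  have hT0 := hL2 t ht
  set T := Real.logb 2 t with hT
  set l := Real.logb 2 T with hl
  set u := Real.logb 2 L with hu
  have hk' : (2 : ℝ) ≤ k := by exact_mod_cast hk
  have hTk : 640 * (k : ℝ) ≤ T := by linarith
  have hTpos : 0 < T := by linarith
  have ht0 : (0 : ℝ) < t := lt_of_lt_of_le (by positivity) ht
  have h2T : (2 : ℝ) ^ T = t := Real.rpow_logb two_pos (by norm_num) ht0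
  have hl10 : 10 ≤ l := by
    rw [hl, Real.le_logb_iff_rpow_le one_lt_two hTpos]
    norm_num
    linarith
  have hm1' : (Fintype.card α : ℝ) ≤ t := by exact_mod_cast hm1
  have hm2' : 2 * (t : ℝ) < 3 * Fintype.card α := by exact_mod_cast hm2
  have haT : 0 < l ^ 2 / T := by positivity
  have htT : T ^ 2 ≤ t := by
    rw [← h2T]
    exact sq_le_two_rpow (by linarith)
  rcases le_total (T ^ 4) L with hcase | hcase
  · set g := L / (6 * k : ℝ) ^ 2 with hg
    have hT2 : 576 * (k : ℝ) ^ 2 * T ^ 2 ≤ L := by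
      have := sq_nonneg (576 * (k : ℝ) ^ 2 - T ^ 2)
      have : 0 ≤ 576 * (k : ℝ) ^ 2 * T ^ 2 := by positivity
      linarith
    have hgT : 16 * T ^ 2 ≤ g := by
      rw [hg, le_div_iff₀ (by positivity)]
      linarith
    have hg16 : 16 ≤ g := by nlinarith
    have hR1 : (⌊g / 8⌋₊ : ℝ) ≤ g / 8 := Nat.floor_le (by linarith)
    have hR2 : g / 8 < ⌊g / 8⌋₊ + 1 := Nat.lt_floor_add_one _
    refine exists_sparse_cut_of_girth K (g := ⌈g⌉₊) (R := ⌊g / 8⌋₊) hdeg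
      (fun v w hw => Nat.ceil_le.mpr (hcyc v w hw)) haT ?_ ?_ ?_
    · push_cast
      have h1 : T ^ 2 / 2 ≤ (Fintype.card α : ℝ) - 1 := by nlinarith
      calc 2 * (6 * (k : ℝ)) < l ^ 2 / T * (T ^ 2 / 2) := by
            have : l ^ 2 / T * (T ^ 2 / 2) = l ^ 2 * T / 2 := by field_simp
            rw [this]
            have : 1 ≤ l ^ 2 := one_le_pow₀ (by linarith)
            nlinarith
        _ ≤ _ := by gcongr
    · refine lt_of_le_of_lt hm1' ?_
      rw [← h2T]
      have ha1 : l ^ 2 / T ≤ 1 := by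
        rw [div_le_one hTpos]
        calc l ^ 2 ≤ 2 ^ l := sq_le_two_rpow (by linarith)
          _ = T := Real.rpow_logb two_pos (by norm_num) hTpos
      have h1 : (2 : ℝ) ^ (l ^ 2 / T) ≤ 1 + l ^ 2 / T := by
        have := rpow_one_add_le_one_add_mul_self (s := 1) (p := l ^ 2 / T) (by norm_num)
          haT.le ha1
        norm_num at this ⊢
        linarith
      calc (2 : ℝ) ^ T < 2 ^ (l ^ 2 / T * ⌊g / 8⌋₊) := by
            refine Real.rpow_lt_rpow_of_exponent_lt one_lt_two ?_
            have h3 : T ^ 2 ≤ ⌊g / 8⌋₊ := by nlinarith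
            calc T < 100 / T * T ^ 2 := by
                  have : 100 / T * T ^ 2 = 100 * T := by field_simp
                  linarith
              _ ≤ _ := by
                gcongr
                nlinarith
        _ = ((2 : ℝ) ^ (l ^ 2 / T)) ^ ⌊g / 8⌋₊ := by
            rw [Real.rpow_mul two_pos.le, Real.rpow_natCast]
        _ ≤ _ := by gcongr
    · rw [Nat.lt_ceil]
      push_cast
      linarith
  · have hul : u ≤ 4 * l := by
      have := Real.logb_le_logb_of_le one_lt_two hL0 hcase
      rwa [Real.logb_pow, Nat.cast_ofNat] at this
    have hu0 : 0 < u + 1 := by linarith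
    set r := ⌊(T - 3) / (u + 1)⌋₊ with hr
    have hr1 : (r : ℝ) * (u + 1) ≤ T - 3 := by
      rw [← le_div_iff₀ hu0]
      exact Nat.floor_le (div_nonneg (by linarith) hu0.le)
    have hr2 : T - 3 < (r + 1) * (u + 1) := by
      rw [← div_lt_iff₀ hu0]
      exact Nat.lt_floor_add_one _
    have hαne : Nonempty α := Fintype.card_pos_iff.mp (by omega)
    obtain ⟨B, hB1, hB2, hB3⟩ := exists_sparse_cut_of_hypercube K (Δ := 6 * k) (r := r)
      (by omega) hdeg f hadj hfib (by
        have h1 : (d : ℝ) + 1 ≤ 2 ^ (u + 1) := by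
          rw [Real.rpow_add two_pos, Real.rpow_one, hu,
            Real.rpow_logb two_pos (by norm_num) hL0]
          have hL1' : 1 ≤ L := le_trans (one_le_pow₀ (by nlinarith)) hL1
          linarith
        have h2 : ((d : ℝ) + 1) ^ r ≤ t / 8 := by
          calc ((d : ℝ) + 1) ^ r ≤ ((2 : ℝ) ^ (u + 1)) ^ r := by gcongr
            _ = 2 ^ (r * (u + 1)) := by
              rw [← Real.rpow_natCast, ← Real.rpow_mul two_pos.le, mul_comm]
            _ ≤ 2 ^ (T - 3) := Real.rpow_le_rpow_of_exponent_le one_le_two hr1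
            _ = t / 8 := by
              rw [Real.rpow_sub two_pos, h2T]
              norm_num
        have h3 : 4 * ((d : ℝ) + 1) ^ r ≤ Fintype.card α := by linarith
        exact_mod_cast h3)
    refine ⟨B, hB1, hB2, ?_⟩
    have h1 : ((K.interedges B Bᶜ).card : ℝ) * (r + 1) ≤ 18 * k * B.card := by
      have : ((K.interedges B Bᶜ).card : ℝ) * (r + 1) ≤ 3 * (6 * k) * B.card := by
        exact_mod_cast hB3
      linarith
    have h2 : 18 * (k : ℝ) ≤ l ^ 2 / T * (r + 1) := by
      have h3 := mul_le_sq_mul_sub_three (T := T) hL (by linarith) (by linarith) hul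
      have h8 : l ^ 2 * (T - 3) ≤ l ^ 2 * ((r + 1) * (u + 1)) := by gcongr
      rw [div_mul_eq_mul_div, le_div_iff₀ hTpos]
      refine le_of_mul_le_mul_right ?_ hu0
      linarith
    refine le_of_mul_le_mul_right ?_ (show (0 : ℝ) < r + 1 by positivity)
    calc _ ≤ _ := h1
      _ ≤ l ^ 2 / T * (r + 1) * B.card := by gcongr
      _ = _ := by ring

/-- Theorem 1.2 (main construction): for all `n, k` with `2 ≤ k ≤ (1/648)·log log n` there is
an `n`-vertex graph `G` with (i) average degree at least `k` and maximum degree at most `6k`,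
(ii) girth at least `log n/(6k)²`, and (iii) every subgraph `H` on `t ≥ log n/(6k)²` vertices
satisfies `sepV H ≤ sep H ≤ (t/log t)·(log log t)²`. -/
theorem stmt0 (n k : ℕ) (hk2 : 2 ≤ k)
    (hk : (k : ℝ) ≤ (1 / 648) * Real.logb 2 (Real.logb 2 n)) :
    ∃ G : SimpleGraph (Fin n),
      -- (i) average degree at least k, maximum degree at most 6k
      ((k : ℝ) * n ≤ 2 * G.edgeSet.ncard) ∧
      (∀ v : Fin n, (G.neighborSet v).ncard ≤ 6 * k) ∧
      -- (ii) girth at least log n / (6k)²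
      (∀ (v : Fin n) (w : G.Walk v v), w.IsCycle →
        Real.logb 2 n / (6 * k : ℝ) ^ 2 ≤ (w.length : ℝ)) ∧
      -- (iii) small separators in all large subgraphs
      (∀ (H : G.Subgraph) (t : ℕ), H.verts.ncard = t →
        Real.logb 2 n / (6 * k : ℝ) ^ 2 ≤ (t : ℝ) →
        sepV H.coe ≤ sep H.coe ∧
        (sep H.coe : ℝ) ≤ (t / Real.logb 2 t) * (Real.logb 2 (Real.logb 2 t)) ^ 2) := by
  classical
  set L := Real.logb 2 n with hL
  have hk2' : (2 : ℝ) ≤ k := by exact_mod_cast hk2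
  have hu : 648 * (k : ℝ) ≤ Real.logb 2 L := by linarith
  have hn : n ≠ 0 := by
    rintro rfl
    simp only [hL, Nat.cast_zero, Real.logb_zero] at hu
    linarith
  have hn0 : (0 : ℝ) < n := by positivity
  have hL0 : 0 < L := by
    refine lt_of_le_of_ne (div_nonneg (Real.log_natCast_nonneg n) (Real.log_nonneg one_le_two)) ?_
    intro h
    rw [← h, Real.logb_zero] at hu
    linarith
  set d := Nat.log 2 n with hd
  have hdL : (d : ℝ) ≤ L := by
    rw [hL, Real.le_logb_iff_rpow_le one_lt_two hn0, Real.rpow_natCast]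
    exact_mod_cast Nat.pow_log_le_self 2 hn
  have hLd : L ≤ d + 1 := by
    rw [hL, Real.logb_le_iff_le_rpow one_lt_two hn0]
    have : (n : ℝ) ≤ 2 ^ (d + 1) := by exact_mod_cast (Nat.lt_pow_succ_log_self one_lt_two n).le
    exact_mod_cast this
  have hkd : 3 * k ≤ d := by
    have h1 := (bounds_of_le_logb hk2 hL0 hu).1
    have h2 : 3 * (k : ℝ) + 1 ≤ (576 * (k : ℝ) ^ 2) ^ 2 := by
      have h3 : 1 ≤ 576 * (k : ℝ) ^ 2 := by nlinarith
      nlinarith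
    have h3 : 3 * (k : ℝ) ≤ d := by linarith
    exact_mod_cast h3
  obtain ⟨G, f, hedges, hdeg, hgirth, hadj, hfib⟩ := exists_sparse_graph_fin hn hk2 hkd
  have hcyc : ∀ (v : Fin n) (w : G.Walk v v), w.IsCycle →
      L / (6 * k : ℝ) ^ 2 ≤ (w.length : ℝ) := by
    intro v w hw
    rw [div_le_iff₀ (by positivity)]
    have h1 : (d : ℝ) + 1 ≤ 36 * (k : ℝ) ^ 2 * w.length := by exact_mod_cast hgirth v w hw
    linarith
  refine ⟨G, by exact_mod_cast hedges, hdeg, hcyc, fun H t hHt ht => ?_⟩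
  have hcardH : Fintype.card H.verts = t := by
    rw [← hHt, ← Nat.card_coe_set_eq, Nat.card_eq_fintype_card]
  have hT := (bounds_of_le_logb hk2 hL0 hu).2 t ht
  have ha : 0 ≤ (Real.logb 2 (Real.logb 2 t)) ^ 2 / Real.logb 2 t :=
    div_nonneg (sq_nonneg _) (by linarith)
  obtain ⟨A, hA1, hA2, hA3⟩ := exists_balanced_cut_of_sparse_cuts H.coe _ ha fun W hW => by
    refine exists_cut_of_comap_cut _ _ W ?_
    let φ : H.coe.comap ((↑) : W → H.verts) →g G := ⟨fun x => x.1.1, fun h => H.adj_sub h⟩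
    have hφ : Function.Injective φ := fun x y h => Subtype.ext (Subtype.ext h)
    have hcardW : Fintype.card W = W.card := Fintype.card_coe W
    rw [← hcardW]
    refine exists_sparse_cut _ hk2 hL0 hu hdL (fun x => ?_) (fun v w hw => ?_) (fun x => f (φ x))
      (fun x y h => hadj _ _ (φ.map_adj h)) (fun y => ?_) ht ?_ ?_
    · refine le_trans ?_ (hdeg (φ x))
      rw [← card_neighborFinset_eq_degree, ← Set.ncard_coe_finset, coe_neighborFinset,
        ← Set.ncard_image_of_injective _ hφ]
      refine Set.ncard_le_ncard ?_ (Set.toFinite _)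
      rintro _ ⟨y, hy, rfl⟩
      exact φ.map_adj hy
    · have := hcyc _ _ (hw.map hφ)
      rwa [Walk.length_map] at this
    · refine le_trans ?_ (hfib y)
      rw [← Finset.card_image_of_injective _ hφ]
      refine Finset.card_le_card fun z hz => ?_
      obtain ⟨x, hx, rfl⟩ := Finset.mem_image.mp hz
      exact Finset.mem_filter.mpr ⟨Finset.mem_univ _, (Finset.mem_filter.mp hx).2⟩
    · rw [hcardW, ← hcardH]
      exact Finset.card_le_univ W
    · rw [hcardW, ← hcardH]
      exact hW
  obtain ⟨h1, h2⟩ := sepV_le_sep_and_sep_le H.coe A hA1 hA2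
  refine ⟨h1, ?_⟩
  calc (sep H.coe : ℝ) ≤ (H.coe.interedges A Aᶜ).card := by exact_mod_cast h2
    _ ≤ _ := hA3
    _ = _ := by
      rw [hcardH]
      ring
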